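/- arXiv:1401.3086 — 4 statements merged into one kernel-verified Lean document; each statement's English description precedes it below -/
import Mathlib

section
/- The Frobenius group L of order 2·3^n and degree 3^n with elementary abelian Frobenius kernel (n ≥ 1) is graph-restrictive: there exists a constant C (depending only on n) such that for every connected simple graph Γ and every vertex-transitive group G ≤ Aut(Γ) with all vertex stabilizers finite such that the pair (Γ,G) is locally L, and for every vertex x of Γ, we have |G_x| ≤ C. -/
open MulAction Pointwise

/-- `V`, the `n`-dimensional vector space over the field with 3 elements. -/
abbrev Vec (n : ℕ) := Fin n → ZMod 3

/-- The translation subgroup `V` of `Perm (Vec n)`. -/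
def TransGrp (n : ℕ) : Subgroup (Equiv.Perm (Vec n)) :=
  Subgroup.closure {f : Equiv.Perm (Vec n) | ∃ w, ∀ v, f v = v + w}

/-- The Frobenius group `L = V ⋊ C₂` of order `2·3^n`, acting on `V = Vec n`
by `v ↦ ε·v + w` with `ε = ±1`: it is generated by the translations and negation. -/
def Lgrp (n : ℕ) : Subgroup (Equiv.Perm (Vec n)) :=
  Subgroup.closure ({f : Equiv.Perm (Vec n) | ∃ w, ∀ v, f v = v + w} ∪ {Equiv.neg (Vec n)})

/-- The pointwise stabilizer `G_u^{[s]}` in `G` of the ball of radius `s` around `u`. -/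
def ballStab {α : Type*} (Γ : SimpleGraph α) (G : Type*) [Group G] [MulAction G α]
    (u : α) (s : ℕ) : Subgroup G :=
  ⨅ w ∈ {w : α | Γ.dist u w ≤ s}, stabilizer G w

/-- `Z_{uw} = Ω₁(Z(G_u ∩ G_w))`, the subgroup generated by the elements of order at most 2
of the centre of the arc stabilizer `G_u ∩ G_w`. -/
def Zuw {α : Type*} (G : Type*) [Group G] [MulAction G α] (u w : α) : Subgroup G :=
  Subgroup.closure {g : G |
    g ∈ (stabilizer G u ⊓ stabilizer G w) ⊓
        Subgroup.centralizer ((stabilizer G u ⊓ stabilizer G w : Subgroup G) : Set G) ∧ g ^ 2 = 1}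

/-- `Z_u = ⟨Z_{uw}^{G_u}⟩`, the normal closure in `G_u` of the subgroups `Z_{uw}`,
for `w` a neighbour of `u` (independent of the choice of `w` by arc-transitivity). -/
def Zsub {α : Type*} (Γ : SimpleGraph α) (G : Type*) [Group G] [MulAction G α]
    (u : α) : Subgroup G :=
  Subgroup.closure {k : G | ∃ h ∈ stabilizer G u, ∃ w ∈ Γ.neighborSet u,
    ∃ g ∈ Zuw G u w, k = h * g * h⁻¹}

/-- The critical distance `b = min { d(u,v) : Z_u ≰ G_v^{[1]} }`. -/
noncomputable def critDist {α : Type*} (Γ : SimpleGraph α) (G : Type*) [Group G]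
    [MulAction G α] : ℕ :=
  sInf {d : ℕ | ∃ u v : α, Γ.dist u v = d ∧ ¬ Zsub Γ G u ≤ ballStab Γ G v 1}

/-- `(u,v)` is a critical pair: `d(u,v) = b` and `Z_u ≰ G_v^{[1]}`. -/
def critPair {α : Type*} (Γ : SimpleGraph α) (G : Type*) [Group G] [MulAction G α]
    (u v : α) : Prop :=
  Γ.dist u v = critDist Γ G ∧ ¬ Zsub Γ G u ≤ ballStab Γ G v 1

/-- `(Γ, G)` is locally `L`: for each vertex `u` there is a bijection
`φ : Γ(u) ≃ V` conjugating the permutation group induced by `G_u` on `Γ(u)`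
to exactly the permutation group `L` acting on `V`. -/
def LocallyL {α : Type*} (n : ℕ) (Γ : SimpleGraph α) (G : Type*) [Group G]
    [MulAction G α] : Prop :=
  ∀ u : α, ∃ φ : Γ.neighborSet u ≃ Vec n,
    (∀ g ∈ stabilizer G u, ∃ l ∈ Lgrp n, ∀ z : Γ.neighborSet u,
      ∃ hz : (g • (z : α)) ∈ Γ.neighborSet u, φ ⟨g • (z : α), hz⟩ = l (φ z)) ∧
    (∀ l ∈ Lgrp n, ∃ g ∈ stabilizer G u, ∀ z : Γ.neighborSet u,
      ∃ hz : (g • (z : α)) ∈ Γ.neighborSet u, φ ⟨g • (z : α), hz⟩ = l (φ z))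

open scoped commutatorElement

section LocalStructure

variable {α : Type*} {G : Type*} [Group G] [MulAction G α]

/-- The stabilizer of the arc `(u, w)`. -/
def arcStab (G : Type*) [Group G] [MulAction G α] (u w : α) : Subgroup G :=
  stabilizer G u ⊓ stabilizer G w

/-- The kernel of the action of the stabilizer of `u` on the neighbours of `u`. -/
def localKernel (Γ : SimpleGraph α) (G : Type*) [Group G] [MulAction G α] (u : α) :
    Subgroup G :=
  stabilizer G u ⊓ ⨅ w ∈ Γ.neighborSet u, stabilizer G w

/-- The centre of the stabilizer of the arc `(u, w)`. -/
def arcCenter (G : Type*) [Group G] [MulAction G α] (u w : α) : Subgroup G :=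
  arcStab G u w ⊓ Subgroup.centralizer (arcStab G u w : Set G)

/-- The subgroup generated by the centres of the stabilizers of the arcs starting at `u`. -/
def vertexCenter (Γ : SimpleGraph α) (G : Type*) [Group G] [MulAction G α] (u : α) :
    Subgroup G :=
  Subgroup.closure {g | ∃ w, Γ.Adj u w ∧ g ∈ arcCenter G u w}

/-- `r` is a nontrivial commutator of an element of the vertex centre at `u` with an element
stabilizing the arc `(u, w)`. -/
def IsArcCommutator (Γ : SimpleGraph α) {G : Type*} [Group G] [MulAction G α]
    (u w : α) (r : G) : Prop :=
  r ≠ 1 ∧ ∃ z ∈ vertexCenter Γ G u, ∃ q ∈ arcStab G u w, ⁅z, q⁆ = r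

/-- A connected graph with a faithful vertex-transitive group with finite vertex stabilizers, in
which the stabilizer of an arc `(u, w)` acts on the neighbours of `u` as a group of order two,
such that the "reflections" obtained in this way satisfy `s * t : w ↦ w'` for `s` a reflection
at `w` and `t` a reflection at `w'`. -/
structure IsLocallyReflective (Γ : SimpleGraph α) (G : Type*) [Group G] [MulAction G α] :
    Prop where
  connected : Γ.Connected
  adj_smul_iff : ∀ (g : G) (u w : α), Γ.Adj u w ↔ Γ.Adj (g • u) (g • w)
  faithful : ∀ g : G, (∀ u : α, g • u = u) → g = 1
  transitive : ∀ u w : α, ∃ g : G, g • u = w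
  finite_stabilizer : ∀ u : α, Finite (stabilizer G u)
  exists_adj : ∀ u, ∃ w, Γ.Adj u w
  exists_reflection : ∀ u w, Γ.Adj u w → ∃ p ∈ arcStab G u w, p ∉ localKernel Γ G u
  mul_smul_eq : ∀ u w w', Γ.Adj u w → Γ.Adj u w' → ∀ s ∈ arcStab G u w, ∀ t ∈ arcStab G u w',
    s ∉ localKernel Γ G u → t ∉ localKernel Γ G u → (s * t) • w = w'
  inv_mul_mem : ∀ u w, Γ.Adj u w → ∀ p ∈ arcStab G u w, ∀ q ∈ arcStab G u w,
    p ∉ localKernel Γ G u → q ∉ localKernel Γ G u → p⁻¹ * q ∈ localKernel Γ G u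

/-- `p 0, …, p b` is a walk such that the vertex centre at `p 0` acts nontrivially on the
neighbours of `p b`. -/
def IsCriticalWalk (Γ : SimpleGraph α) (G : Type*) [Group G] [MulAction G α] (b : ℕ)
    (p : ℕ → α) : Prop :=
  (∀ i < b, Γ.Adj (p i) (p (i + 1))) ∧ ¬ vertexCenter Γ G (p 0) ≤ localKernel Γ G (p b)

/-- `b` is the minimal length of a critical walk. -/
structure IsCriticalLength (Γ : SimpleGraph α) (G : Type*) [Group G] [MulAction G α] (b : ℕ) :
    Prop where
  exists_walk : ∃ p, IsCriticalWalk Γ G b p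
  le_of_dist_lt : ∀ u v, Γ.dist u v < b → vertexCenter Γ G u ≤ localKernel Γ G v

variable {Γ : SimpleGraph α} {u v w : α} {g h r : G}

lemma mem_arcStab : g ∈ arcStab G u w ↔ g • u = u ∧ g • w = w := by
  simp [arcStab, Subgroup.mem_inf]

lemma arcStab_comm (u w : α) : arcStab G u w = arcStab G w u := inf_comm _ _

lemma mem_localKernel :
    g ∈ localKernel Γ G u ↔ g • u = u ∧ ∀ w, Γ.Adj u w → g • w = w := by
  simp [localKernel, Subgroup.mem_inf, Subgroup.mem_iInf]

lemma mem_arcCenter :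
    g ∈ arcCenter G u w ↔ g ∈ arcStab G u w ∧ ∀ h ∈ arcStab G u w, Commute g h := by
  simp only [arcCenter, Subgroup.mem_inf, Subgroup.mem_centralizer_iff, SetLike.mem_coe]
  exact and_congr_right fun _ => forall₂_congr fun _ _ => eq_comm

lemma arcCenter_comm (u w : α) : arcCenter G u w = arcCenter G w u := by
  rw [arcCenter, arcStab_comm, arcCenter]

lemma localKernel_le_arcStab (h : Γ.Adj u w) : localKernel Γ G u ≤ arcStab G u w := by
  intro g hg
  rw [mem_localKernel] at hg
  exact mem_arcStab.2 ⟨hg.1, hg.2 w h⟩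

lemma arcCenter_le_vertexCenter (h : Γ.Adj u w) : arcCenter G u w ≤ vertexCenter Γ G u :=
  fun _ hg => Subgroup.subset_closure ⟨w, h, hg⟩

lemma conj_mem_arcStab (h : G) (hg : g ∈ arcStab G u w) :
    h * g * h⁻¹ ∈ arcStab G (h • u) (h • w) := by
  rw [mem_arcStab] at *
  simp [mul_smul, hg.1, hg.2]

lemma conj_mem_arcCenter (h : G) (hg : g ∈ arcCenter G u w) :
    h * g * h⁻¹ ∈ arcCenter G (h • u) (h • w) := by
  rw [mem_arcCenter] at *
  refine ⟨conj_mem_arcStab h hg.1, fun k hk => ?_⟩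
  have hk' : h⁻¹ * k * h ∈ arcStab G u w := by simpa using conj_mem_arcStab h⁻¹ hk
  have := (hg.2 _ hk').conj h
  simpa [mul_assoc] using this

lemma commutatorElement_mul_left_of_commute {f s k : G} (h : Commute s k) :
    ⁅f * s, k⁆ = ⁅f, k⁆ := by
  have : s * k * s⁻¹ = k := by rw [h.eq, mul_inv_cancel_right]
  calc ⁅f * s, k⁆ = f * (s * k * s⁻¹) * f⁻¹ * k⁻¹ := by rw [commutatorElement_def]; group
    _ = ⁅f, k⁆ := by rw [this, commutatorElement_def]

lemma commutatorElement_mul_right_of_commute {f s k : G} (h : Commute s f) :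
    ⁅f, k * s⁆ = ⁅f, k⁆ := by
  rw [← commutatorElement_inv, commutatorElement_mul_left_of_commute h, commutatorElement_inv]

lemma conj_mem_commutator {A B : Subgroup G} (hA : ∀ k ∈ A, h * k * h⁻¹ ∈ A)
    (hB : ∀ k ∈ B, h * k * h⁻¹ ∈ B) : ∀ k ∈ ⁅A, B⁆, h * k * h⁻¹ ∈ ⁅A, B⁆ := by
  intro k hk
  have h1 : (⁅A, B⁆).map (MulAut.conj h).toMonoidHom ≤ ⁅A, B⁆ := by
    rw [Subgroup.map_commutator]
    exact Subgroup.commutator_mono (by rintro _ ⟨a, ha, rfl⟩; exact hA a ha)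
      (by rintro _ ⟨a, ha, rfl⟩; exact hB a ha)
  exact h1 ⟨k, hk, rfl⟩

lemma card_le_two_mul_card_inf {X K : Subgroup G} [Finite X]
    (h : ∀ a ∈ X, ∀ b ∈ X, a ∉ K → b ∉ K → a⁻¹ * b ∈ K) :
    Nat.card X ≤ 2 * Nat.card (X ⊓ K : Subgroup G) := by
  classical
  by_cases hX : X ≤ K
  · rw [inf_eq_left.2 hX]; omega
  obtain ⟨a, ha, haK⟩ := SetLike.not_le_iff_exists.1 hX
  have : Finite (X ⊓ K : Subgroup G) :=
    Finite.of_injective _ (Subgroup.inclusion_injective (inf_le_left : X ⊓ K ≤ X))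
  let f : X → Bool × (X ⊓ K : Subgroup G) := fun x =>
    if hx : (x : G) ∈ K then (true, ⟨x, x.2, hx⟩)
    else (false, ⟨a⁻¹ * x, X.mul_mem (X.inv_mem ha) x.2, h a ha x x.2 haK hx⟩)
  have hf : Function.Injective f := by
    intro x y hxy
    ext
    by_cases hx : (x : G) ∈ K <;> by_cases hy : (y : G) ∈ K <;> simp [f, hx, hy] at hxy
    exacts [congrArg (fun z : (X ⊓ K : Subgroup G) => (z : G)) hxy,
      mul_left_cancel (congrArg (fun z : (X ⊓ K : Subgroup G) => (z : G)) hxy)]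
  calc Nat.card X ≤ Nat.card (Bool × (X ⊓ K : Subgroup G)) := Nat.card_le_card_of_injective f hf
    _ = _ := by simp [Nat.card_prod]

end LocalStructure

namespace IsLocallyReflective

variable {α : Type*} {G : Type*} [Group G] [MulAction G α] {Γ : SimpleGraph α}
  {u v w w' : α} {g h r : G}

lemma adj_smul (hL : IsLocallyReflective Γ G) (g : G) (h : Γ.Adj u w) :
    Γ.Adj (g • u) (g • w) := (hL.adj_smul_iff g u w).1 h

lemma adj_smul_right (hL : IsLocallyReflective Γ G) (hg : g • u = u) (h : Γ.Adj u w) :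
    Γ.Adj u (g • w) := by simpa [hg] using hL.adj_smul g h

lemma conj_mem_localKernel (hL : IsLocallyReflective Γ G) (h : G)
    (hg : g ∈ localKernel Γ G u) : h * g * h⁻¹ ∈ localKernel Γ G (h • u) := by
  rw [mem_localKernel] at *
  refine ⟨by simp [mul_smul, hg.1], fun w hw => ?_⟩
  have := hL.adj_smul h⁻¹ hw
  rw [inv_smul_smul] at this
  simp [mul_smul, hg.2 _ this]

lemma conj_mem_localKernel_iff (hL : IsLocallyReflective Γ G) (h : G) :
    h * g * h⁻¹ ∈ localKernel Γ G (h • u) ↔ g ∈ localKernel Γ G u := by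
  refine ⟨fun hg => ?_, hL.conj_mem_localKernel h⟩
  simpa [mul_assoc] using hL.conj_mem_localKernel h⁻¹ hg

lemma conj_mem_vertexCenter (hL : IsLocallyReflective Γ G) (h : G)
    (hg : g ∈ vertexCenter Γ G u) : h * g * h⁻¹ ∈ vertexCenter Γ G (h • u) := by
  induction hg using Subgroup.closure_induction with
  | mem x hx =>
    obtain ⟨w, hw, hx⟩ := hx
    exact Subgroup.subset_closure ⟨h • w, hL.adj_smul h hw, conj_mem_arcCenter h hx⟩
  | one => simp
  | mul x y _ _ hx hy => simpa [mul_assoc] using mul_mem hx hy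
  | inv x _ hx => simpa [mul_assoc] using inv_mem hx

lemma conj_mem_vertexCenter_iff (hL : IsLocallyReflective Γ G) (h : G) :
    h * g * h⁻¹ ∈ vertexCenter Γ G (h • u) ↔ g ∈ vertexCenter Γ G u := by
  refine ⟨fun hg => ?_, hL.conj_mem_vertexCenter h⟩
  simpa [mul_assoc] using hL.conj_mem_vertexCenter h⁻¹ hg

lemma conj_smul_vertexCenter (hL : IsLocallyReflective Γ G) (h : G) :
    MulAut.conj h • vertexCenter Γ G u = vertexCenter Γ G (h • u) := by
  ext g
  rw [Subgroup.mem_pointwise_smul_iff_inv_smul_mem, ← hL.conj_mem_vertexCenter_iff h]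
  simp [← map_inv, MulAut.smul_def, mul_assoc]

lemma conj_isArcCommutator (hL : IsLocallyReflective Γ G) (h : G)
    (hr : IsArcCommutator Γ u w r) : IsArcCommutator Γ (h • u) (h • w) (h * r * h⁻¹) := by
  obtain ⟨h1, z, hz, q, hq, rfl⟩ := hr
  refine ⟨by simpa using h1, _, hL.conj_mem_vertexCenter h hz, _, conj_mem_arcStab h hq, ?_⟩
  simp only [commutatorElement_def]
  group

lemma vertexCenter_smul_le_localKernel_smul_iff (hL : IsLocallyReflective Γ G) (h : G) :
    vertexCenter Γ G (h • u) ≤ localKernel Γ G (h • v) ↔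
      vertexCenter Γ G u ≤ localKernel Γ G v := by
  constructor
  · intro H g hg
    exact (hL.conj_mem_localKernel_iff h).1 (H (hL.conj_mem_vertexCenter h hg))
  · intro H g hg
    have : h⁻¹ * g * h ∈ vertexCenter Γ G u := by
      simpa using hL.conj_mem_vertexCenter h⁻¹ hg
    simpa [mul_assoc] using hL.conj_mem_localKernel h (H this)

lemma finite_arcStab (hL : IsLocallyReflective Γ G) (u w : α) : Finite (arcStab G u w) :=
  have := hL.finite_stabilizer u
  Finite.of_injective _
    (Subgroup.inclusion_injective (inf_le_left : arcStab G u w ≤ stabilizer G u))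

/-- A subgroup containing the local kernel and a reflection at `w` contains the whole arc
stabilizer. -/
lemma arcStab_le (hL : IsLocallyReflective Γ G) (hw : Γ.Adj u w) {H : Subgroup G}
    (hH : localKernel Γ G u ≤ H) {p : G} (hp : p ∈ arcStab G u w)
    (hpQ : p ∉ localKernel Γ G u) (hpH : p ∈ H) : arcStab G u w ≤ H := by
  intro q hq
  by_cases hqQ : q ∈ localKernel Γ G u
  · exact hH hqQ
  · simpa using H.mul_mem hpH (hH (hL.inv_mul_mem u w hw p hp q hq hpQ hqQ))

lemma exists_smul_eq (hL : IsLocallyReflective Γ G) (hw : Γ.Adj u w) (hw' : Γ.Adj u w')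
    {H : Subgroup G} (hH : arcStab G u w ≤ H) (hH' : arcStab G u w' ≤ H) :
    ∃ g ∈ H, g • u = u ∧ g • w = w' := by
  obtain ⟨s, hs, hsQ⟩ := hL.exists_reflection u w hw
  obtain ⟨t, ht, htQ⟩ := hL.exists_reflection u w' hw'
  refine ⟨s * t, H.mul_mem (hH hs) (hH' ht), ?_, hL.mul_smul_eq u w w' hw hw' s hs t ht hsQ htQ⟩
  rw [mul_smul, (mem_arcStab.1 ht).1, (mem_arcStab.1 hs).1]

/-- The arc stabilizers of the arcs at `u` generate the stabilizer of `u`. -/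
lemma stabilizer_le (hL : IsLocallyReflective Γ G) {H : Subgroup G}
    (hH : ∀ w, Γ.Adj u w → arcStab G u w ≤ H) : stabilizer G u ≤ H := by
  intro g hg
  obtain ⟨w, hw⟩ := hL.exists_adj u
  obtain ⟨k, hkH, hku, hkw⟩ := hL.exists_smul_eq hw (hL.adj_smul_right hg hw) (hH _ hw)
    (hH _ (hL.adj_smul_right hg hw))
  have : k⁻¹ * g ∈ arcStab G u w := by
    rw [mem_arcStab, mul_smul, mul_smul, inv_smul_eq_iff, inv_smul_eq_iff, hku, hkw]
    exact ⟨hg, rfl⟩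
  simpa using H.mul_mem hkH (hH w hw this)

lemma exists_smul_arc (hL : IsLocallyReflective Γ G) (hw : Γ.Adj u w) {u' : α}
    (hw' : Γ.Adj u' w') : ∃ g : G, g • u = u' ∧ g • w = w' := by
  obtain ⟨g, rfl⟩ := hL.transitive u u'
  obtain ⟨k, -, hk, hk'⟩ := hL.exists_smul_eq (hL.adj_smul g hw) hw' (H := ⊤) le_top le_top
  exact ⟨k * g, by rw [mul_smul, hk], by rw [mul_smul, hk']⟩

/-- A set of vertices closed under taking neighbours is everything. -/
lemma forall_of_adj (hL : IsLocallyReflective Γ G) {p : α → Prop} (hu : p u)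
    (hp : ∀ a b, Γ.Adj a b → p a → p b) (v : α) : p v := by
  obtain ⟨q⟩ := hL.connected.preconnected u v
  induction q with
  | nil => exact hu
  | cons h _ ih => exact ih (hp _ _ h hu)

/-- A subgroup of an arc stabilizer normalized by both vertex stabilizers is trivial. -/
lemma eq_bot_of_normalized (hL : IsLocallyReflective Γ G) (hw : Γ.Adj u w) {K : Subgroup G}
    (hK : K ≤ arcStab G u w) (hu : ∀ h ∈ stabilizer G u, ∀ k ∈ K, h * k * h⁻¹ ∈ K)
    (hw' : ∀ h ∈ stabilizer G w, ∀ k ∈ K, h * k * h⁻¹ ∈ K) : K = ⊥ := by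
  let H : Subgroup G := stabilizer G u ⊔ stabilizer G w
  have hH : ∀ h ∈ H, ∀ k ∈ K, h⁻¹ * k * h ∈ K := by
    intro h hh
    have hh' : h ∈ Subgroup.closure ((stabilizer G u : Set G) ∪ stabilizer G w) := by
      rwa [Subgroup.closure_union, Subgroup.closure_eq, Subgroup.closure_eq]
    clear hh
    induction hh' using Subgroup.closure_induction'' with
    | mem x hx =>
      intro k hk
      rcases hx with hx | hx
      · simpa using hu x⁻¹ (inv_mem hx) k hk
      · simpa using hw' x⁻¹ (inv_mem hx) k hk
    | one => simp
    | inv_mem x hx =>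
      intro k hk
      rcases hx with hx | hx
      · simpa using hu x hx k hk
      · simpa using hw' x hx k hk
    | mul x y _ _ hx hy => intro k hk; simpa [mul_assoc] using hy _ (hx k hk)
  have key : ∀ v : α, ∃ h ∈ H, v = h • u ∨ v = h • w := by
    refine hL.forall_of_adj (u := u) ⟨1, one_mem _, by simp⟩ ?_
    rintro a b hab ⟨h, hh, rfl | rfl⟩
    · have h1 := hL.adj_smul h⁻¹ hab
      rw [inv_smul_smul] at h1
      obtain ⟨k, hk, -, hk'⟩ := hL.exists_smul_eq (H := stabilizer G u) hw h1 inf_le_left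
        inf_le_left
      exact ⟨h * k, mul_mem hh (Subgroup.mem_sup_left hk), .inr (by simp [mul_smul, hk'])⟩
    · have h1 := hL.adj_smul h⁻¹ hab
      rw [inv_smul_smul] at h1
      obtain ⟨k, hk, -, hk'⟩ := hL.exists_smul_eq (H := stabilizer G w) hw.symm h1 inf_le_left
        inf_le_left
      exact ⟨h * k, mul_mem hh (Subgroup.mem_sup_right hk), .inl (by simp [mul_smul, hk'])⟩
  rw [Subgroup.eq_bot_iff_forall]
  refine fun k hk => hL.faithful k fun v => ?_
  obtain ⟨h, hh, hv⟩ := key v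
  have h1 := mem_arcStab.1 (hK (hH h hh k hk))
  simp only [mul_smul, inv_smul_eq_iff] at h1
  rcases hv with rfl | rfl
  exacts [h1.1, h1.2]

lemma eq_one_of_commute (hL : IsLocallyReflective Γ G) (hw : Γ.Adj u w) {z : G}
    (hz : z ∈ arcStab G u w) (hu : ∀ h ∈ stabilizer G u, Commute z h)
    (hw' : ∀ h ∈ stabilizer G w, Commute z h) : z = 1 := by
  have hconj : ∀ h, Commute z h → ∀ k ∈ Subgroup.zpowers z, h * k * h⁻¹ ∈ Subgroup.zpowers z := by
    rintro h hh k hk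
    obtain ⟨i, rfl⟩ := Subgroup.mem_zpowers_iff.1 hk
    rwa [← (hh.zpow_left i).eq, mul_inv_cancel_right]
  have := hL.eq_bot_of_normalized hw (K := Subgroup.zpowers z) (by simpa using hz)
    (fun h hh => hconj h (hu h hh)) (fun h hh => hconj h (hw' h hh))
  simpa using this

lemma isPGroup_arcStab (hL : IsLocallyReflective Γ G) (hw : Γ.Adj u w) :
    IsPGroup 2 (arcStab G u w) := by
  have hsq : ∀ a b, Γ.Adj a b → ∀ g ∈ arcStab G a b, g ^ 2 ∈ localKernel Γ G a := by
    intro a b hab g hg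
    by_cases hgQ : g ∈ localKernel Γ G a
    · exact pow_mem hgQ 2
    · simpa [pow_two] using hL.inv_mul_mem a b hab g⁻¹ (inv_mem hg) g hg (by simpa using hgQ) hgQ
  have hodd : ∀ g ∈ arcStab G u w, Odd (orderOf g) → g = 1 := by
    intro g hg ho
    have hstep : ∀ a b, Γ.Adj a b → g ∈ arcStab G a b → g ∈ localKernel Γ G a := by
      intro a b hab hgab
      obtain ⟨m, hm⟩ := ho
      have : g = (g ^ 2) ^ (m + 1) := by
        rw [← pow_mul, show 2 * (m + 1) = orderOf g + 1 by omega, pow_succ, pow_orderOf_eq_one,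
          one_mul]
      rw [this]
      exact pow_mem (hsq a b hab g hgab) _
    refine hL.faithful g fun v => ?_
    have : g ∈ localKernel Γ G v := by
      refine hL.forall_of_adj (p := fun v => g ∈ localKernel Γ G v) (hstep u w hw hg) ?_ v
      intro a b hab ha
      exact hstep b a hab.symm (arcStab_comm (G := G) a b ▸ localKernel_le_arcStab hab ha)
    exact (mem_localKernel.1 this).1
  have := hL.finite_arcStab u w
  rintro ⟨g, hg⟩
  have hg0 : orderOf g ≠ 0 := by
    have := orderOf_pos (⟨g, hg⟩ : arcStab G u w)
    rw [Subgroup.orderOf_mk] at this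
    omega
  refine ⟨(orderOf g).factorization 2, Subtype.ext ?_⟩
  refine hodd _ (pow_mem hg _) ?_
  rw [SubmonoidClass.mk_pow, orderOf_pow_of_dvd (by positivity) (Nat.ordProj_dvd _ _)]
  exact Nat.odd_iff.2 (by
    have := Nat.not_dvd_ordCompl Nat.prime_two hg0
    omega)

lemma arcCenter_ne_bot (hL : IsLocallyReflective Γ G) (hw : Γ.Adj u w) :
    arcCenter G u w ≠ ⊥ := by
  have := hL.finite_arcStab u w
  obtain ⟨p, hp, hpQ⟩ := hL.exists_reflection u w hw
  have : Nontrivial (arcStab G u w) :=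
    ⟨⟨p, hp⟩, 1, fun h => hpQ (by rw [show p = 1 from congrArg Subtype.val h]; exact one_mem _)⟩
  have hc := (hL.isPGroup_arcStab hw).center_nontrivial
  obtain ⟨⟨⟨z, hz⟩, hzc⟩, hz1⟩ := exists_ne (1 : Subgroup.center (arcStab G u w))
  intro hbot
  have : z ∈ arcCenter G u w := mem_arcCenter.2 ⟨hz, fun h hh =>
    (congrArg Subtype.val (Subgroup.mem_center_iff.1 hzc ⟨h, hh⟩)).symm⟩
  rw [hbot, Subgroup.mem_bot] at this
  subst this
  exact hz1 rfl

variable {b : ℕ} {p : ℕ → α}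

lemma card_arcStab_le (hL : IsLocallyReflective Γ G) (hw : Γ.Adj u w) :
    Nat.card (arcStab G u w) ≤
      4 * Nat.card (localKernel Γ G u ⊓ localKernel Γ G w : Subgroup G) := by
  have := hL.finite_arcStab u w
  have h1 := card_le_two_mul_card_inf (hL.inv_mul_mem u w hw)
  rw [inf_eq_right.2 (localKernel_le_arcStab hw)] at h1
  have : Finite (localKernel Γ G u) :=
    Finite.of_injective _ (Subgroup.inclusion_injective (localKernel_le_arcStab hw))
  have h2 : Nat.card (localKernel Γ G u) ≤
      2 * Nat.card (localKernel Γ G u ⊓ localKernel Γ G w : Subgroup G) := by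
    refine card_le_two_mul_card_inf fun a ha c hc => hL.inv_mul_mem w u hw.symm a ?_ c ?_
    · exact arcStab_comm (G := G) u w ▸ localKernel_le_arcStab hw ha
    · exact arcStab_comm (G := G) u w ▸ localKernel_le_arcStab hw hc
  omega

lemma commute_of_mem_localKernel {z : G} (hz : z ∈ vertexCenter Γ G u)
    (hg : g ∈ localKernel Γ G u) : Commute z g := by
  induction hz using Subgroup.closure_induction with
  | mem x hx =>
    obtain ⟨w, hw, hx⟩ := hx
    exact (mem_arcCenter.1 hx).2 g (localKernel_le_arcStab hw hg)
  | one => exact Commute.one_left g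
  | mul x y _ _ hx hy => exact hx.mul_left hy
  | inv x _ hx => exact hx.inv_left

lemma conj_mem_vertexCenter_of_mem (hL : IsLocallyReflective Γ G) (hh : h ∈ stabilizer G u)
    (hg : g ∈ vertexCenter Γ G u) : h * g * h⁻¹ ∈ vertexCenter Γ G u := by
  have := hL.conj_mem_vertexCenter h hg
  rwa [mem_stabilizer_iff.1 hh] at this

lemma conj_mem_localKernel_of_mem (hL : IsLocallyReflective Γ G) (hh : h ∈ stabilizer G u)
    (hg : g ∈ localKernel Γ G u) : h * g * h⁻¹ ∈ localKernel Γ G u := by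
  have := hL.conj_mem_localKernel h hg
  rwa [mem_stabilizer_iff.1 hh] at this

/-- If the arc centre acts nontrivially on a neighbourhood, the arc stabilizer is small. -/
lemma card_arcStab_le_four (hL : IsLocallyReflective Γ G) (hw : Γ.Adj u w)
    (hZ : ¬ arcCenter G u w ≤ localKernel Γ G u) : Nat.card (arcStab G u w) ≤ 4 := by
  have hall : ∀ a c, Γ.Adj a c → ¬ arcCenter G a c ≤ localKernel Γ G a := by
    intro a c hac H
    obtain ⟨g, rfl, rfl⟩ := hL.exists_smul_arc hw hac
    exact hZ fun z hz => (hL.conj_mem_localKernel_iff g).1 (H (conj_mem_arcCenter g hz))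
  have hnorm : ∀ a c, Γ.Adj a c → ∀ h ∈ stabilizer G a,
      ∀ k ∈ localKernel Γ G a ⊓ localKernel Γ G c, h * k * h⁻¹ ∈
        localKernel Γ G a ⊓ localKernel Γ G c := by
    intro a c hac
    suffices H : stabilizer G a ≤ Subgroup.normalizer
        ((localKernel Γ G a ⊓ localKernel Γ G c : Subgroup G) : Set G) by
      intro h hh k hk
      exact (Subgroup.mem_normalizer_iff.1 (H hh) k).1 hk
    refine hL.stabilizer_le fun d had => ?_
    obtain ⟨z, hz, hzQ⟩ := SetLike.not_le_iff_exists.1 (hall a d had)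
    refine hL.arcStab_le had ?_ (mem_arcCenter.1 hz).1 hzQ ?_
    · intro q hq
      have hqc : q ∈ stabilizer G c := (mem_arcStab.1 (localKernel_le_arcStab hac hq)).2
      have hqc' : q⁻¹ ∈ stabilizer G c := inv_mem hqc
      rw [Subgroup.mem_normalizer_iff]
      refine fun k => ⟨fun hk => ⟨mul_mem (mul_mem hq hk.1) ((localKernel Γ G a).inv_mem hq),
        hL.conj_mem_localKernel_of_mem hqc hk.2⟩, fun hk => ?_⟩
      have h1 := mul_mem (mul_mem ((localKernel Γ G a).inv_mem hq) hk.1) hq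
      have h2 := hL.conj_mem_localKernel_of_mem hqc' hk.2
      simp only [mul_assoc, inv_mul_cancel_left, inv_mul_cancel, mul_one, inv_inv] at h1 h2
      exact ⟨h1, h2⟩
    · refine Subgroup.centralizer_le_normalizer _ (Subgroup.mem_centralizer_iff.2 fun k hk => ?_)
      exact ((mem_arcCenter.1 hz).2 k (localKernel_le_arcStab had hk.1)).eq.symm
  have hbot : localKernel Γ G u ⊓ localKernel Γ G w = ⊥ := by
    refine hL.eq_bot_of_normalized hw (inf_le_left.trans (localKernel_le_arcStab hw))
      (hnorm u w hw) ?_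
    have := hnorm w u hw.symm
    rwa [inf_comm] at this
  have := hL.card_arcStab_le hw
  rw [hbot] at this
  simpa using this

section CentralCase

variable (hL : IsLocallyReflective Γ G)
  (hZ : ∀ u w, Γ.Adj u w → arcCenter G u w ≤ localKernel Γ G u)

include hZ in
lemma vertexCenter_le_localKernel (u : α) : vertexCenter Γ G u ≤ localKernel Γ G u := by
  rw [vertexCenter, Subgroup.closure_le]
  rintro z ⟨w, hw, hz⟩
  exact hZ u w hw hz

include hZ in
lemma commute_vertexCenter {z z' : G} (hz : z ∈ vertexCenter Γ G u)
    (hz' : z' ∈ vertexCenter Γ G u) : Commute z z' :=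
  commute_of_mem_localKernel hz (vertexCenter_le_localKernel hZ u hz')

include hL in
lemma vertexCenter_ne_bot (u : α) : vertexCenter Γ G u ≠ ⊥ := by
  obtain ⟨w, hw⟩ := hL.exists_adj u
  exact fun h => hL.arcCenter_ne_bot hw (le_bot_iff.1 (h ▸ arcCenter_le_vertexCenter hw))

include hL hZ in
lemma mem_localKernel_of_commute (hw : Γ.Adj u w) (hg : g ∈ arcStab G u w)
    (hc : ∀ z ∈ vertexCenter Γ G u, Commute z g) : g ∈ localKernel Γ G u := by
  by_contra hgQ
  have hP : arcStab G u w ≤ Subgroup.centralizer (vertexCenter Γ G u) :=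
    hL.arcStab_le hw
      (fun q hq => Subgroup.mem_centralizer_iff.2 fun z hz =>
        (commute_of_mem_localKernel hz hq).eq) hg hgQ
      (Subgroup.mem_centralizer_iff.2 fun z hz => (hc z hz).eq)
  have h1 : vertexCenter Γ G u ≤ arcCenter G u w := fun z hz => mem_arcCenter.2
    ⟨localKernel_le_arcStab hw (vertexCenter_le_localKernel hZ u hz), fun k hk =>
      Subgroup.mem_centralizer_iff.1 (hP hk) z hz⟩
  have h2 : vertexCenter Γ G w ≤ arcCenter G w u := by
    obtain ⟨k, hk, hk'⟩ := hL.exists_smul_arc hw hw.symm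
    intro z hz
    have h3 : k⁻¹ * z * k ∈ vertexCenter Γ G u := by
      simpa [← hk] using hL.conj_mem_vertexCenter k⁻¹ hz
    have := conj_mem_arcCenter k (h1 h3)
    rw [hk, hk'] at this
    simpa [mul_assoc] using this
  have e1 := h1.antisymm (arcCenter_le_vertexCenter hw)
  have e2 := h2.antisymm (arcCenter_le_vertexCenter hw.symm)
  rw [arcCenter_comm] at e2
  refine hL.arcCenter_ne_bot hw (hL.eq_bot_of_normalized hw inf_le_left ?_ ?_)
  · rw [← e1]; exact fun h hh k hk => hL.conj_mem_vertexCenter_of_mem hh hk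
  · rw [← e2]; exact fun h hh k hk => hL.conj_mem_vertexCenter_of_mem hh hk

end CentralCase

lemma dist_le_of_adj (hL : IsLocallyReflective Γ G) (hp : ∀ i < b, Γ.Adj (p i) (p (i + 1)))
    {i j : ℕ} (hij : i ≤ j) (hj : j ≤ b) : Γ.dist (p i) (p j) ≤ j - i := by
  induction j, hij using Nat.le_induction with
  | base => simp
  | succ j hij ih =>
    have h1 := ih (by omega)
    have h2 := (hL.connected.dist_triangle (u := p i) (v := p j) (w := p (j + 1)))
    rw [(SimpleGraph.dist_eq_one_iff_adj).2 (hp j (by omega))] at h2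
    omega

lemma exists_isCriticalLength (hL : IsLocallyReflective Γ G) (u : α)
    (hZ : ∀ u w, Γ.Adj u w → arcCenter G u w ≤ localKernel Γ G u) :
    ∃ b, IsCriticalLength Γ G (b + 1) := by
  classical
  have hex : ∃ d, ∃ u v, Γ.dist u v = d ∧ ¬ vertexCenter Γ G u ≤ localKernel Γ G v := by
    by_contra! H
    refine hL.vertexCenter_ne_bot u (Subgroup.eq_bot_iff_forall _ |>.2 fun z hz => ?_)
    exact hL.faithful z fun v => (mem_localKernel.1 (H _ u v rfl hz)).1
  obtain ⟨x, y, hxy, hn⟩ := Nat.find_spec hex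
  have hpos : Nat.find hex ≠ 0 := by
    intro h0
    rw [h0, hL.connected.dist_eq_zero_iff] at hxy
    exact hn (hxy ▸ vertexCenter_le_localKernel hZ x)
  refine ⟨Nat.find hex - 1, ?_⟩
  rw [Nat.sub_add_cancel (Nat.one_le_iff_ne_zero.2 hpos)]
  refine ⟨?_, fun u v huv => ?_⟩
  · obtain ⟨q, hq⟩ := hL.connected.exists_walk_length_eq_dist x y
    rw [hxy] at hq
    exact ⟨q.getVert, fun i hi => q.adj_getVert_succ (hq ▸ hi), by simpa [← hq] using hn⟩
  · by_contra H
    exact Nat.find_min hex huv ⟨u, v, rfl, H⟩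

/-- The main commutator computation on a critical walk of minimal length. -/
lemma exists_isArcCommutator_aux (hL : IsLocallyReflective Γ G)
    (hZ : ∀ u w, Γ.Adj u w → arcCenter G u w ≤ localKernel Γ G u)
    (hb : IsCriticalLength Γ G (b + 1)) (hp : IsCriticalWalk Γ G (b + 1) p) :
    (∃ t ∈ vertexCenter Γ G (p (b + 1)), t ∉ localKernel Γ G (p 0)) ∧
    vertexCenter Γ G (p (b + 1)) ≤ arcStab G (p 0) (p 1) ∧
    ∃ r : G, IsArcCommutator Γ (p 0) (p 1) r ∧ IsArcCommutator Γ (p (b + 1)) (p b) r⁻¹ ∧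
      ∀ r', IsArcCommutator Γ (p 0) (p 1) r' → r' = r := by
  obtain ⟨hadj, hnot⟩ := hp
  have h01 : Γ.Adj (p 0) (p 1) := hadj 0 (by omega)
  have hbb : Γ.Adj (p b) (p (b + 1)) := hadj b (by omega)
  have hle1 : vertexCenter Γ G (p 0) ≤ arcStab G (p (b + 1)) (p b) := by
    rw [arcStab_comm]
    refine (hb.le_of_dist_lt _ _ ?_).trans (localKernel_le_arcStab hbb)
    have := hL.dist_le_of_adj hadj (i := 0) (j := b) (by omega) (by omega)
    omega
  have hle2 : vertexCenter Γ G (p (b + 1)) ≤ arcStab G (p 0) (p 1) := by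
    rw [arcStab_comm]
    refine (hb.le_of_dist_lt _ _ ?_).trans (localKernel_le_arcStab h01.symm)
    have := hL.dist_le_of_adj hadj (i := 1) (j := b + 1) (by omega) (by omega)
    rw [SimpleGraph.dist_comm]
    omega
  obtain ⟨s, hs, hsQ⟩ := SetLike.not_le_iff_exists.1 hnot
  obtain ⟨t, ht, hst⟩ : ∃ t ∈ vertexCenter Γ G (p (b + 1)), ¬ Commute t s := by
    by_contra! H
    exact hsQ (hL.mem_localKernel_of_commute hZ hbb.symm (hle1 hs) H)
  have htQ : t ∉ localKernel Γ G (p 0) := fun h =>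
    hst (commute_of_mem_localKernel hs h).symm
  have hr1 : ⁅s, t⁆ ≠ 1 := fun h => hst (commutatorElement_eq_one_iff_commute.1 h).symm
  refine ⟨⟨t, ht, htQ⟩, hle2, ⁅s, t⁆, ⟨hr1, s, hs, t, hle2 ht, rfl⟩,
    ⟨inv_ne_one.2 hr1, t, ht, s, hle1 hs, (commutatorElement_inv s t).symm⟩, ?_⟩
  rintro r' ⟨hr', z, hz, q, hq, rfl⟩
  have hqQ : q ∉ localKernel Γ G (p 0) := fun h =>
    hr' (commutatorElement_eq_one_iff_commute.2 (commute_of_mem_localKernel hz h))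
  have h1 : ⁅z, q⁆ = ⁅z, t⁆ := by
    have := hL.inv_mul_mem _ _ h01 t (hle2 ht) q hq htQ hqQ
    rw [← mul_inv_cancel_left t q,
      commutatorElement_mul_right_of_commute (commute_of_mem_localKernel hz this).symm]
  have hzQ : z ∉ localKernel Γ G (p (b + 1)) := fun h => by
    rw [h1] at hr'
    exact hr' (commutatorElement_eq_one_iff_commute.2 (commute_of_mem_localKernel ht h).symm)
  have := hL.inv_mul_mem _ _ hbb.symm s (hle1 hs) z (hle1 hz) hsQ hzQ
  rw [h1, ← mul_inv_cancel_left s z,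
    commutatorElement_mul_left_of_commute (commute_of_mem_localKernel ht this).symm]

section Critical

variable {r' : G} (hL : IsLocallyReflective Γ G)
  (hZ : ∀ u w, Γ.Adj u w → arcCenter G u w ≤ localKernel Γ G u)
  (hb : IsCriticalLength Γ G (b + 1))

include hL hZ hb

lemma isArcCommutator_unique (hw : Γ.Adj u w) (hr : IsArcCommutator Γ u w r)
    (hr' : IsArcCommutator Γ u w r') : r = r' := by
  obtain ⟨p, hp⟩ := hb.exists_walk
  obtain ⟨-, -, r₀, -, -, huniq⟩ := hL.exists_isArcCommutator_aux hZ hb hp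
  obtain ⟨g, hg, hg'⟩ := hL.exists_smul_arc hw (hp.1 0 (by omega))
  have h1 := huniq (g * r * g⁻¹) (hg ▸ hg' ▸ hL.conj_isArcCommutator g hr)
  have h2 := huniq (g * r' * g⁻¹) (hg ▸ hg' ▸ hL.conj_isArcCommutator g hr')
  simpa using h1.trans h2.symm

lemma exists_isArcCommutator (hw : Γ.Adj u w) : ∃ r : G, IsArcCommutator Γ u w r := by
  obtain ⟨p, hp⟩ := hb.exists_walk
  obtain ⟨-, -, r₀, hr₀, -, -⟩ := hL.exists_isArcCommutator_aux hZ hb hp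
  obtain ⟨g, hg, hg'⟩ := hL.exists_smul_arc (hp.1 0 (by omega)) hw
  exact ⟨_, hg ▸ hg' ▸ hL.conj_isArcCommutator g hr₀⟩

omit hb hZ in
lemma mem_vertexCenter_of_isArcCommutator (hr : IsArcCommutator Γ u w r) :
    r ∈ vertexCenter Γ G u := by
  obtain ⟨-, z, hz, q, hq, rfl⟩ := hr
  have := mul_mem hz (hL.conj_mem_vertexCenter_of_mem (mem_arcStab.1 hq).1 (inv_mem hz))
  simpa [commutatorElement_def, mul_assoc] using this

lemma commute_of_isArcCommutator (hw : Γ.Adj u w) (hr : IsArcCommutator Γ u w r)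
    (hg : g ∈ arcStab G u w) : Commute r g := by
  have h1 := hL.conj_isArcCommutator g hr
  rw [mem_arcStab] at hg
  rw [hg.1, hg.2] at h1
  exact (mul_inv_eq_iff_eq_mul.1 (hL.isArcCommutator_unique hZ hb hw h1 hr)).symm

lemma inv_eq_of_isArcCommutator (hw : Γ.Adj u w) (hr : IsArcCommutator Γ u w r) : r⁻¹ = r := by
  refine hL.isArcCommutator_unique hZ hb hw ?_ hr
  obtain ⟨hr1, z, hz, q, hq, rfl⟩ := hr
  refine ⟨inv_ne_one.2 hr1, z⁻¹, inv_mem hz, q, hq, ?_⟩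
  have h1 := commute_vertexCenter hZ hz (hL.conj_mem_vertexCenter_of_mem (mem_arcStab.1 hq).1 hz)
  simpa [commutatorElement_def, mul_assoc] using h1.inv_left.eq

lemma exists_isArcCommutator_of_walk (hp : IsCriticalWalk Γ G (b + 1) p) :
    ∃ r : G, IsArcCommutator Γ (p 0) (p 1) r ∧ IsArcCommutator Γ (p (b + 1)) (p b) r := by
  obtain ⟨-, -, r, h1, h2, -⟩ := hL.exists_isArcCommutator_aux hZ hb hp
  rw [hL.inv_eq_of_isArcCommutator hZ hb (hp.1 0 (by omega)) h1] at h2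
  exact ⟨r, h1, h2⟩

lemma commutator_eq_one_or (hw : Γ.Adj u w) (hr : IsArcCommutator Γ u w r) {z q : G}
    (hz : z ∈ vertexCenter Γ G u) (hq : q ∈ arcStab G u w) : ⁅z, q⁆ = 1 ∨ ⁅z, q⁆ = r :=
  or_iff_not_imp_left.2 fun h =>
    hL.isArcCommutator_unique hZ hb hw ⟨h, z, hz, q, hq, rfl⟩ hr

lemma commute_of_commute_iff (hw : Γ.Adj u w) {z z' q : G} (hz : z ∈ vertexCenter Γ G u)
    (hz' : z' ∈ vertexCenter Γ G u) (hq : q ∈ arcStab G u w)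
    (hzz : Commute z q ↔ Commute z' q) : Commute (z'⁻¹ * z) q := by
  by_cases h : Commute z q
  · exact (hzz.1 h).inv_left.mul_left h
  · have h1 : ⁅z, q⁆ = ⁅z', q⁆ := hL.isArcCommutator_unique hZ hb hw
      ⟨fun H => h (commutatorElement_eq_one_iff_commute.1 H), z, hz, q, hq, rfl⟩
      ⟨fun H => h (hzz.2 (commutatorElement_eq_one_iff_commute.1 H)), z', hz', q, hq, rfl⟩
    rw [commutatorElement_def, commutatorElement_def, mul_left_inj, mul_inv_eq_iff_eq_mul] at h1
    rw [commute_iff_eq, mul_assoc, h1]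
    simp [mul_assoc]

lemma card_arcCenter_le (hw : Γ.Adj u w) [Finite (Γ.neighborSet u)] [Finite (Γ.neighborSet w)] :
    Nat.card (arcCenter G u w) ≤
      2 ^ Nat.card (Γ.neighborSet u) * 2 ^ Nat.card (Γ.neighborSet w) := by
  choose p hp hpQ using hL.exists_reflection
  let f : arcCenter G u w → (Γ.neighborSet u → Prop) × (Γ.neighborSet w → Prop) := fun z =>
    (fun x => Commute (z : G) (p u x x.2), fun x => Commute (z : G) (p w x x.2))
  have key : ∀ a, ∀ z ∈ vertexCenter Γ G a, ∀ z' ∈ vertexCenter Γ G a,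
      (∀ x (hx : Γ.Adj a x), Commute z (p a x hx) ↔ Commute z' (p a x hx)) →
      ∀ h ∈ stabilizer G a, Commute (z'⁻¹ * z) h := by
    intro a z hz z' hz' hzz
    suffices H : stabilizer G a ≤ Subgroup.centralizer {z'⁻¹ * z} from fun h hh =>
      Subgroup.mem_centralizer_iff.1 (H hh) _ rfl
    refine hL.stabilizer_le fun x hx => hL.arcStab_le hx ?_ (hp a x hx) (hpQ a x hx) ?_
    · refine fun q hq => Subgroup.mem_centralizer_iff.2 ?_
      rintro _ rfl
      exact commute_of_mem_localKernel (mul_mem (inv_mem hz') hz) hq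
    · refine Subgroup.mem_centralizer_iff.2 ?_
      rintro _ rfl
      exact hL.commute_of_commute_iff hZ hb hx hz hz' (hp a x hx) (hzz x hx)
  have hf : Function.Injective f := by
    rintro ⟨z, hz⟩ ⟨z', hz'⟩ hzz
    obtain ⟨h1, h2⟩ := Prod.ext_iff.1 hzz
    refine Subtype.ext ?_
    have hz1 := arcCenter_comm (G := G) u w ▸ hz
    have hz1' := arcCenter_comm (G := G) u w ▸ hz'
    have := hL.eq_one_of_commute hw (z := z'⁻¹ * z)
      (mul_mem (inv_mem (mem_arcCenter.1 hz').1) (mem_arcCenter.1 hz).1)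
      (key u z (arcCenter_le_vertexCenter hw hz) z' (arcCenter_le_vertexCenter hw hz')
        fun x hx => iff_of_eq (congrFun h1 ⟨x, hx⟩))
      (key w z (arcCenter_le_vertexCenter hw.symm hz1) z'
        (arcCenter_le_vertexCenter hw.symm hz1') fun x hx => iff_of_eq (congrFun h2 ⟨x, hx⟩))
    exact (inv_mul_eq_one.1 this).symm
  refine (Nat.card_le_card_of_injective f hf).trans_eq ?_
  rw [Nat.card_prod, Nat.card_fun, Nat.card_fun]
  simp

omit hb hZ in
lemma localKernel_not_le (hZ : ∀ u w, Γ.Adj u w → arcCenter G u w ≤ localKernel Γ G u)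
    (hw : Γ.Adj u w) : ¬ localKernel Γ G w ≤ localKernel Γ G u := by
  intro H
  obtain ⟨g, hg, hg'⟩ := hL.exists_smul_arc hw hw.symm
  have H' : localKernel Γ G u ≤ localKernel Γ G w := by
    intro q hq
    rw [← hL.conj_mem_localKernel_iff g⁻¹] at hq ⊢
    rw [inv_smul_eq_iff.2 hg'.symm] at hq
    rw [inv_smul_eq_iff.2 hg.symm]
    exact H hq
  have he := H.antisymm H'
  refine hL.vertexCenter_ne_bot u (le_bot_iff.1 ((vertexCenter_le_localKernel hZ u).trans
    (hL.eq_bot_of_normalized hw (localKernel_le_arcStab hw) ?_ ?_).le))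
  · exact fun h hh k hk => hL.conj_mem_localKernel_of_mem hh hk
  · rw [← he]; exact fun h hh k hk => hL.conj_mem_localKernel_of_mem hh hk

omit hb in
lemma arcStab_le_of_localKernel_le (hw : Γ.Adj u w) {H : Subgroup G}
    (h1 : localKernel Γ G u ≤ H) (h2 : localKernel Γ G w ≤ H) : arcStab G u w ≤ H := by
  obtain ⟨q, hq, hqu⟩ := SetLike.not_le_iff_exists.1 (hL.localKernel_not_le hZ hw)
  exact hL.arcStab_le hw h1
    (arcStab_comm (G := G) w u ▸ localKernel_le_arcStab hw.symm hq) hqu (h2 hq)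

end Critical

lemma exists_eq_or_eq_mul (hL : IsLocallyReflective Γ G) (hw : Γ.Adj u w) {s q : G}
    (hs : s ∈ localKernel Γ G u) (hsw : s ∉ localKernel Γ G w) (hq : q ∈ localKernel Γ G u) :
    ∃ f ∈ localKernel Γ G u ⊓ localKernel Γ G w, q = f ∨ q = f * s := by
  have hP : ∀ q ∈ localKernel Γ G u, q ∈ arcStab G w u := fun q hq =>
    arcStab_comm (G := G) u w ▸ localKernel_le_arcStab hw hq
  by_cases hqw : q ∈ localKernel Γ G w
  · exact ⟨q, ⟨hq, hqw⟩, .inl rfl⟩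
  · refine ⟨q * s⁻¹, ⟨(localKernel Γ G u).mul_mem hq (inv_mem hs), ?_⟩, .inr (by simp)⟩
    simpa using hL.inv_mul_mem w u hw.symm q⁻¹ (inv_mem (hP q hq)) s⁻¹ (inv_mem (hP s hs))
      (by simpa using hqw) (by simpa using hsw)

lemma commutator_le_localKernel :
    ⁅localKernel Γ G u, localKernel Γ G u⁆ ≤ localKernel Γ G u := by
  rw [Subgroup.commutator_le]
  intro a ha c hc
  rw [commutatorElement_def]
  exact mul_mem (mul_mem (mul_mem ha hc) (inv_mem ha)) (inv_mem hc)

lemma commutator_localKernel_le (hL : IsLocallyReflective Γ G)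
    (hZ : ∀ u w, Γ.Adj u w → arcCenter G u w ≤ localKernel Γ G u) (hw : Γ.Adj u w)
    (hn : ¬ vertexCenter Γ G u ≤ localKernel Γ G w) :
    ⁅localKernel Γ G u, localKernel Γ G u⁆ ≤
      ⁅localKernel Γ G u ⊓ localKernel Γ G w, localKernel Γ G u ⊓ localKernel Γ G w⁆ := by
  obtain ⟨s, hs, hsQ⟩ := SetLike.not_le_iff_exists.1 hn
  have hdec : ∀ q ∈ localKernel Γ G u, ∃ f ∈ localKernel Γ G u ⊓ localKernel Γ G w,
      ∃ z ∈ vertexCenter Γ G u, q = f * z := by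
    intro q hq
    obtain ⟨f, hf, h | h⟩ :=
      hL.exists_eq_or_eq_mul hw (vertexCenter_le_localKernel hZ u hs) hsQ hq
    exacts [⟨f, hf, 1, one_mem _, by rw [h, mul_one]⟩, ⟨f, hf, s, hs, h⟩]
  rw [Subgroup.commutator_le]
  intro a ha c hc
  obtain ⟨f, hf, z, hz, rfl⟩ := hdec a ha
  obtain ⟨f', hf', z', hz', rfl⟩ := hdec c hc
  rw [commutatorElement_mul_left_of_commute (commute_of_mem_localKernel hz hc),
    commutatorElement_mul_right_of_commute (commute_of_mem_localKernel hz' hf.1)]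
  exact Subgroup.commutator_mem_commutator hf hf'

/-- If the critical length is one, the local kernels are abelian. -/
lemma card_arcStab_le_of_length_one (hL : IsLocallyReflective Γ G)
    (hZ : ∀ u w, Γ.Adj u w → arcCenter G u w ≤ localKernel Γ G u)
    (hb : IsCriticalLength Γ G 1) (hw : Γ.Adj u w) :
    Nat.card (arcStab G u w) ≤ 4 * Nat.card (arcCenter G u w) := by
  obtain ⟨p, hp, hpn⟩ := hb.exists_walk
  have hn : ∀ a c, Γ.Adj a c → ¬ vertexCenter Γ G a ≤ localKernel Γ G c := by
    intro a c hac
    obtain ⟨g, hg, hg'⟩ := hL.exists_smul_arc (hp 0 (by omega)) hac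
    rw [← hg, ← hg', hL.vertexCenter_smul_le_localKernel_smul_iff]
    exact hpn
  have h1 := hL.commutator_localKernel_le hZ hw (hn u w hw)
  have h2 := hL.commutator_localKernel_le hZ hw.symm (hn w u hw.symm)
  have h3 : ⁅localKernel Γ G u, localKernel Γ G u⁆ = ⁅localKernel Γ G w, localKernel Γ G w⁆ :=
    le_antisymm (h1.trans (Subgroup.commutator_mono inf_le_right inf_le_right))
      (h2.trans (Subgroup.commutator_mono inf_le_right inf_le_right))
  have hbot : ⁅localKernel Γ G u, localKernel Γ G u⁆ = ⊥ := by
    refine hL.eq_bot_of_normalized hw ?_ ?_ ?_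
    · exact commutator_le_localKernel.trans (localKernel_le_arcStab hw)
    · exact fun h hh => conj_mem_commutator (fun k hk => hL.conj_mem_localKernel_of_mem hh hk)
        (fun k hk => hL.conj_mem_localKernel_of_mem hh hk)
    · rw [h3]
      exact fun h hh => conj_mem_commutator (fun k hk => hL.conj_mem_localKernel_of_mem hh hk)
        (fun k hk => hL.conj_mem_localKernel_of_mem hh hk)
  have hcomm : ∀ a, ⁅localKernel Γ G a, localKernel Γ G a⁆ = ⊥ →
      ∀ q ∈ localKernel Γ G a, ∀ q' ∈ localKernel Γ G a, Commute q q' := fun a ha q hq q' hq' =>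
    commutatorElement_eq_one_iff_commute.1
      (Subgroup.mem_bot.1 (ha ▸ Subgroup.commutator_mem_commutator hq hq'))
  have hF : localKernel Γ G u ⊓ localKernel Γ G w ≤ arcCenter G u w := by
    refine fun f hf => mem_arcCenter.2 ⟨localKernel_le_arcStab hw hf.1, fun k hk => ?_⟩
    have : arcStab G u w ≤ Subgroup.centralizer {f} := by
      refine hL.arcStab_le_of_localKernel_le hZ hw ?_ ?_
      · refine fun q hq => Subgroup.mem_centralizer_iff.2 ?_
        rintro _ rfl
        exact hcomm u hbot _ hf.1 q hq
      · refine fun q hq => Subgroup.mem_centralizer_iff.2 ?_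
        rintro _ rfl
        exact hcomm w (h3 ▸ hbot) _ hf.2 q hq
    exact Subgroup.mem_centralizer_iff.1 (this hk) f rfl
  have := hL.finite_arcStab u w
  have : Finite (arcCenter G u w) :=
    Finite.of_injective _ (Subgroup.inclusion_injective inf_le_left)
  have h4 := hL.card_arcStab_le hw
  have h5 : Nat.card (localKernel Γ G u ⊓ localKernel Γ G w : Subgroup G) ≤
      Nat.card (arcCenter G u w) := Subgroup.card_le_of_le hF
  omega

lemma isCriticalWalk_smul (hL : IsLocallyReflective Γ G) (g : G) (hp : IsCriticalWalk Γ G b p) :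
    IsCriticalWalk Γ G b (fun i => g • p i) :=
  ⟨fun i hi => hL.adj_smul g (hp.1 i hi), fun H =>
    hp.2 ((hL.vertexCenter_smul_le_localKernel_smul_iff g).1 H)⟩

lemma exists_isCriticalWalk (hL : IsLocallyReflective Γ G) (hb : IsCriticalLength Γ G b) {i : ℕ}
    (hi : i < b) (hw : Γ.Adj u w) : ∃ p, IsCriticalWalk Γ G b p ∧ p i = u ∧ p (i + 1) = w := by
  obtain ⟨p, hp⟩ := hb.exists_walk
  obtain ⟨g, hg, hg'⟩ := hL.exists_smul_arc (hp.1 i hi) hw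
  exact ⟨_, hL.isCriticalWalk_smul g hp, hg, hg'⟩

/-- Two vertices `w` and `w'` adjacent to `u` are equivalent if their vertex centres generate the
same subgroup modulo the vertex centre at `u`. -/
def CenterEquiv (Γ : SimpleGraph α) (G : Type*) [Group G] [MulAction G α] (u w w' : α) : Prop :=
  vertexCenter Γ G u ⊔ vertexCenter Γ G w = vertexCenter Γ G u ⊔ vertexCenter Γ G w'

lemma centerEquiv_smul (hL : IsLocallyReflective Γ G) (g : G) (h : CenterEquiv Γ G u w w') :
    CenterEquiv Γ G (g • u) (g • w) (g • w') := by
  have := congrArg (MulAut.conj g • ·) h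
  simp only [Subgroup.smul_sup, hL.conj_smul_vertexCenter] at this
  exact this

lemma centerEquiv_smul_of_mem (hL : IsLocallyReflective Γ G) (hg : g ∈ stabilizer G u)
    (h : CenterEquiv Γ G u w w') : CenterEquiv Γ G u (g • w) (g • w') := by
  have := hL.centerEquiv_smul g h
  rwa [mem_stabilizer_iff.1 hg] at this

/-- `r` is the nontrivial commutator of some arc ending at `u`. -/
def IsVertexCommutator (Γ : SimpleGraph α) {G : Type*} [Group G] [MulAction G α] (u : α)
    (r : G) : Prop :=
  ∃ w, Γ.Adj u w ∧ IsArcCommutator Γ w u r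

/-- The walk `w, p 0, p 1, …`. -/
def consWalk (w : α) (p : ℕ → α) : ℕ → α
  | 0 => w
  | i + 1 => p i

section LongCritical

variable (hL : IsLocallyReflective Γ G)
  (hZ : ∀ u w, Γ.Adj u w → arcCenter G u w ≤ localKernel Γ G u)
  (hb : IsCriticalLength Γ G (b + 2))

include hb in
lemma vertexCenter_le_localKernel_of_adj (hw : Γ.Adj u w) :
    vertexCenter Γ G w ≤ localKernel Γ G u := by
  refine hb.le_of_dist_lt w u ?_
  rw [SimpleGraph.dist_eq_one_iff_adj.2 hw.symm]
  omega

include hL hZ hb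

lemma exists_not_centerEquiv (hw : Γ.Adj u w) : ∃ w', Γ.Adj u w' ∧ ¬ CenterEquiv Γ G u w' w := by
  by_contra! H
  obtain ⟨g, hg, hg'⟩ := hL.exists_smul_arc hw hw.symm
  have H' : ∀ y, Γ.Adj w y → CenterEquiv Γ G w y u := by
    intro y hy
    have hy' := hL.adj_smul g⁻¹ hy
    rw [inv_smul_eq_iff.2 hg.symm] at hy'
    have := hL.centerEquiv_smul g (H _ hy')
    rwa [hg, hg', smul_inv_smul] at this
  have hnorm : ∀ a c, Γ.Adj a c → (∀ y, Γ.Adj a y → CenterEquiv Γ G a y c) →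
      ∀ h ∈ stabilizer G a, ∀ k ∈ vertexCenter Γ G a ⊔ vertexCenter Γ G c,
        h * k * h⁻¹ ∈ vertexCenter Γ G a ⊔ vertexCenter Γ G c := by
    intro a c hac hE h hh k hk
    have h1 := Subgroup.smul_mem_pointwise_smul k (MulAut.conj h) _ hk
    rwa [Subgroup.smul_sup, hL.conj_smul_vertexCenter, hL.conj_smul_vertexCenter,
      mem_stabilizer_iff.1 hh, hE _ (hL.adj_smul_right hh hac)] at h1
  have hbot : vertexCenter Γ G u ⊔ vertexCenter Γ G w = ⊥ := by
    refine hL.eq_bot_of_normalized hw (sup_le ?_ ?_) (hnorm u w hw H) ?_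
    · exact (vertexCenter_le_localKernel hZ u).trans (localKernel_le_arcStab hw)
    · exact (vertexCenter_le_localKernel_of_adj hb hw).trans (localKernel_le_arcStab hw)
    · rw [sup_comm]
      exact hnorm w u hw.symm H'
  exact hL.vertexCenter_ne_bot u (sup_eq_bot_iff.1 hbot).1

/-- A critical walk can be extended backwards and shortened at the end. -/
lemma isCriticalWalk_consWalk (hp : IsCriticalWalk Γ G (b + 2) p) (hw : Γ.Adj (p 0) w)
    (hE : ¬ CenterEquiv Γ G (p 0) w (p 1)) : IsCriticalWalk Γ G (b + 2) (consWalk w p) := by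
  have h01 : Γ.Adj (p 0) (p 1) := hp.1 0 (by omega)
  have hbb : Γ.Adj (p (b + 1)) (p (b + 2)) := hp.1 (b + 1) (by omega)
  refine ⟨fun i hi => ?_, fun H => hE ?_⟩
  · cases i with
    | zero => exact hw.symm
    | succ i => exact hp.1 i (by omega)
  change vertexCenter Γ G w ≤ localKernel Γ G (p (b + 1)) at H
  obtain ⟨⟨t, ht, htQ⟩, hle, -⟩ := hL.exists_isArcCommutator_aux hZ hb hp
  obtain ⟨r, hr, hr'⟩ := hL.exists_isArcCommutator_of_walk hZ hb hp
  have hconj : ∀ t ∈ vertexCenter Γ G (p (b + 2)), vertexCenter Γ G (p 0) ⊔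
      vertexCenter Γ G (t • w) ≤ vertexCenter Γ G (p 0) ⊔ vertexCenter Γ G w := by
    intro t ht
    refine sup_le le_sup_left ?_
    rw [← hL.conj_smul_vertexCenter]
    rintro _ ⟨z, hz, rfl⟩
    have hzP : z ∈ arcStab G (p (b + 2)) (p (b + 1)) :=
      arcStab_comm (G := G) (p (b + 1)) _ ▸ localKernel_le_arcStab hbb (H hz)
    have h1 : ⁅t, z⁆ ∈ vertexCenter Γ G (p 0) := by
      rcases hL.commutator_eq_one_or hZ hb hbb.symm hr' ht hzP with h | h <;> rw [h]
      exacts [one_mem _, hL.mem_vertexCenter_of_isArcCommutator hr]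
    have h2 := mul_mem (Subgroup.mem_sup_left (T := vertexCenter Γ G w) h1)
      (Subgroup.mem_sup_right hz)
    simpa [commutatorElement_def] using h2
  have htu : t • p 0 = p 0 := (mem_arcStab.1 (hle ht)).1
  have hEt : CenterEquiv Γ G (p 0) w (t • w) := by
    refine le_antisymm ?_ (hconj t ht)
    have := Subgroup.pointwise_smul_le_pointwise_smul_iff (a := MulAut.conj t) |>.2
      (hconj t⁻¹ (inv_mem ht))
    simpa only [Subgroup.smul_sup, hL.conj_smul_vertexCenter, htu, smul_inv_smul] using this
  obtain ⟨s, hs, hsQ⟩ := hL.exists_reflection _ _ hw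
  have := hL.centerEquiv_smul_of_mem (mem_arcStab.1 hs).1 hEt
  rwa [(mem_arcStab.1 hs).2, ← mul_smul,
    hL.mul_smul_eq _ w (p 1) hw h01 s hs t (hle ht) hsQ htQ] at this

lemma commute_of_not_centerEquiv (hw : Γ.Adj u w) (hw' : Γ.Adj u w')
    (hE : ¬ CenterEquiv Γ G u w w') (hr : IsArcCommutator Γ w u r) (hg : g ∈ arcStab G u w') :
    Commute r g := by
  obtain ⟨p, hp, rfl, rfl⟩ := hL.exists_isCriticalWalk hb (i := 0) (by omega) hw'
  obtain ⟨⟨t, ht, htQ⟩, hle, -⟩ := hL.exists_isArcCommutator_aux hZ hb hp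
  obtain ⟨r', h1, h2⟩ := hL.exists_isArcCommutator_of_walk hZ hb
    (hL.isCriticalWalk_consWalk hZ hb hp hw hE)
  rw [show r' = r from hL.isArcCommutator_unique hZ hb hw.symm h1 hr] at h2
  have h3 : r ∈ vertexCenter Γ G (p (b + 1)) := hL.mem_vertexCenter_of_isArcCommutator h2
  have hP : arcStab G (p 0) (p (0 + 1)) ≤ Subgroup.centralizer {r} := by
    refine hL.arcStab_le hw' (fun q hq => ?_) (hle ht) htQ ?_
    · refine Subgroup.mem_centralizer_singleton_iff.2 (Commute.eq ?_)
      exact (hL.commute_of_isArcCommutator hZ hb hw.symm hr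
        (arcStab_comm (G := G) w _ ▸ localKernel_le_arcStab hw hq)).symm
    · refine Subgroup.mem_centralizer_singleton_iff.2 (Commute.eq ?_)
      exact commute_of_mem_localKernel ht
        (vertexCenter_le_localKernel_of_adj hb (hp.1 (b + 1) (by omega)).symm h3)
  exact (Subgroup.mem_centralizer_singleton_iff.1 (hP hg)).symm

lemma commute_of_mem_stabilizer (hw : Γ.Adj u w) (hr : IsArcCommutator Γ w u r)
    (hg : g ∈ stabilizer G u) : Commute r g := by
  have hS : stabilizer G u ≤ Subgroup.centralizer {r} := by
    refine hL.stabilizer_le fun x hx k hk => Subgroup.mem_centralizer_singleton_iff.2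
      (Commute.eq (Commute.symm ?_))
    by_cases hE : CenterEquiv Γ G u w x
    swap
    · exact hL.commute_of_not_centerEquiv hZ hb hw hx hE hr hk
    obtain ⟨y, hy, hyE⟩ := hL.exists_not_centerEquiv hZ hb hw
    replace hyE : ¬ CenterEquiv Γ G u w y := fun h => hyE h.symm
    obtain ⟨s, hs, hsQ⟩ := hL.exists_reflection u y hy
    obtain ⟨t, ht, htQ⟩ := hL.exists_reflection u w hw
    have hsu := (mem_arcStab.1 hs).1
    by_cases hEd : CenterEquiv Γ G u w (s • x)
    · have h1 := hEd.trans (hL.centerEquiv_smul_of_mem hsu hE).symm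
      have h2 := hL.centerEquiv_smul_of_mem (mem_arcStab.1 ht).1 h1
      rw [← mul_smul, hL.mul_smul_eq u w y hw hy t ht s hs htQ hsQ, (mem_arcStab.1 ht).2] at h2
      exact absurd h2 hyE
    · have hrs : Commute r s := hL.commute_of_not_centerEquiv hZ hb hw hy hyE hr hs
      have hk' := conj_mem_arcStab s hk
      rw [hsu] at hk'
      have h1 : Commute r (s * k * s⁻¹) :=
        hL.commute_of_not_centerEquiv hZ hb hw (hL.adj_smul_right hsu hx) hEd hr hk'
      simpa [mul_assoc] using (hrs.inv_right.mul_right h1).mul_right hrs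
  exact (Subgroup.mem_centralizer_singleton_iff.1 (hS hg)).symm

lemma isVertexCommutator_unique {r' : G} (hr : IsVertexCommutator Γ u r)
    (hr' : IsVertexCommutator Γ u r') : r = r' := by
  obtain ⟨w, hw, hr⟩ := hr
  obtain ⟨w', hw', hr'⟩ := hr'
  obtain ⟨g, -, hg, rfl⟩ := hL.exists_smul_eq hw hw' (H := ⊤) le_top le_top
  have h1 := hL.conj_isArcCommutator g hr
  rw [hg, ← (hL.commute_of_mem_stabilizer hZ hb hw hr hg).eq, mul_inv_cancel_right] at h1
  exact hL.isArcCommutator_unique hZ hb hw'.symm h1 hr'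

lemma exists_isVertexCommutator (u : α) : ∃ r : G, IsVertexCommutator Γ u r := by
  obtain ⟨w, hw⟩ := hL.exists_adj u
  obtain ⟨r, hr⟩ := hL.exists_isArcCommutator hZ hb hw.symm
  exact ⟨r, w, hw, hr⟩

lemma commute_of_isVertexCommutator (hr : IsVertexCommutator Γ u r) (hg : g ∈ stabilizer G u) :
    Commute r g := by
  obtain ⟨w, hw, hr⟩ := hr
  exact hL.commute_of_mem_stabilizer hZ hb hw hr hg

omit hZ in
lemma mem_localKernel_of_isVertexCommutator (hr : IsVertexCommutator Γ u r) :
    r ∈ localKernel Γ G u := by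
  obtain ⟨w, hw, hr⟩ := hr
  exact vertexCenter_le_localKernel_of_adj hb hw (hL.mem_vertexCenter_of_isArcCommutator hr)

lemma exists_isVertexCommutator_of_walk (hp : IsCriticalWalk Γ G (b + 2) p) :
    ∃ r : G, IsVertexCommutator Γ (p 1) r ∧ IsVertexCommutator Γ (p (b + 1)) r := by
  obtain ⟨r, h1, h2⟩ := hL.exists_isArcCommutator_of_walk hZ hb hp
  exact ⟨r, ⟨_, (hp.1 0 (by omega)).symm, h1⟩, ⟨_, hp.1 (b + 1) (by omega), h2⟩⟩

omit hb in
lemma isVertexCommutator_of_not_centerEquiv (hb : IsCriticalLength Γ G (b + 3)) {w₀ : α}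
    (hw : Γ.Adj u w) (hw' : Γ.Adj u w') (hw₀ : Γ.Adj u w₀) (hE : ¬ CenterEquiv Γ G u w w₀)
    (hE' : ¬ CenterEquiv Γ G u w' w₀) (hr : IsVertexCommutator Γ w r) :
    IsVertexCommutator Γ w' r := by
  obtain ⟨p, hp, rfl, rfl⟩ := hL.exists_isCriticalWalk hb (i := 0) (by omega) hw₀
  have key : ∀ x, Γ.Adj (p 0) x → ¬ CenterEquiv Γ G (p 0) x (p (0 + 1)) →
      ∃ r : G, IsVertexCommutator Γ x r ∧ IsVertexCommutator Γ (p b) r := by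
    intro x hx hxE
    obtain ⟨y, hy, hyE⟩ := hL.exists_not_centerEquiv hZ (b := b + 1) hb hx.symm
    exact hL.exists_isVertexCommutator_of_walk hZ (b := b + 1) hb
      (hL.isCriticalWalk_consWalk hZ (b := b + 1) hb
        (hL.isCriticalWalk_consWalk hZ (b := b + 1) hb hp hx hxE) hy hyE)
  obtain ⟨r₁, h1, h2⟩ := key w hw hE
  obtain ⟨r₂, h3, h4⟩ := key w' hw' hE'
  rwa [hL.isVertexCommutator_unique hZ (b := b + 1) hb hr h1,
    hL.isVertexCommutator_unique hZ (b := b + 1) hb h2 h4]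

omit hb in
lemma not_isCriticalLength_add_three (u : α) : ¬ IsCriticalLength Γ G (b + 3) := by
  intro hb
  obtain ⟨w, hw⟩ := hL.exists_adj u
  obtain ⟨r, hr⟩ := hL.exists_isVertexCommutator hZ (b := b + 1) hb w
  have hall : ∀ x, Γ.Adj u x → IsVertexCommutator Γ x r := by
    intro x hx
    by_cases hE : CenterEquiv Γ G u w x
    · obtain ⟨y, hy, hyE⟩ := hL.exists_not_centerEquiv hZ (b := b + 1) hb hw
      replace hyE : ¬ CenterEquiv Γ G u w y := fun h => hyE h.symm
      exact hL.isVertexCommutator_of_not_centerEquiv hZ hb hw hx hy hyE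
        (fun h => hyE (hE.trans h)) hr
    · obtain ⟨s, hs, hsQ⟩ := hL.exists_reflection u w hw
      obtain ⟨t, ht, htQ⟩ := hL.exists_reflection u x hx
      refine hL.isVertexCommutator_of_not_centerEquiv hZ hb hw hx
        (hL.adj_smul_right (mem_arcStab.1 hs).1 hx) (fun h => hE ?_) (fun h => hE ?_) hr
      · have := hL.centerEquiv_smul_of_mem (inv_mem (mem_arcStab.1 hs).1) h
        rwa [inv_smul_smul, inv_smul_eq_iff.2 (mem_arcStab.1 hs).2.symm] at this
      · have := hL.centerEquiv_smul_of_mem (mem_arcStab.1 ht).1 h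
        rw [← mul_smul, hL.mul_smul_eq u x w hx hw t ht s hs htQ hsQ, (mem_arcStab.1 ht).2] at this
        exact this.symm
  refine hr.choose_spec.2.1 (hL.eq_one_of_commute hw (z := r) ?_ ?_ ?_)
  · rw [arcStab_comm]
    exact localKernel_le_arcStab hw.symm
      (hL.mem_localKernel_of_isVertexCommutator (b := b + 1) hb hr)
  · intro h hh
    refine (Subgroup.mem_centralizer_singleton_iff.1
      (hL.stabilizer_le (H := Subgroup.centralizer {r}) (fun x hx k hk => ?_) hh)).symm
    exact Subgroup.mem_centralizer_singleton_iff.2 (hL.commute_of_isVertexCommutator hZ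
      (b := b + 1) hb (hall x hx) (mem_arcStab.1 hk).2).eq.symm
  · exact fun h hh => hL.commute_of_isVertexCommutator hZ (b := b + 1) hb hr hh

end LongCritical

section LengthTwo

variable (hL : IsLocallyReflective Γ G)
  (hZ : ∀ u w, Γ.Adj u w → arcCenter G u w ≤ localKernel Γ G u)
  (hb : IsCriticalLength Γ G 2)

include hL hZ hb

lemma exists_mem_localKernel_commute_commutator (hw : Γ.Adj u w) :
    ∃ z ∈ localKernel Γ G u, z ∉ localKernel Γ G w ∧
      (∀ m ∈ ⁅localKernel Γ G u, localKernel Γ G u⁆, Commute z m) ∧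
      ∃ r ∈ arcCenter G u w, ∀ q ∈ localKernel Γ G u, ⁅z, q⁆ = 1 ∨ ⁅z, q⁆ = r := by
  obtain ⟨p, hp, rfl, rfl⟩ := hL.exists_isCriticalWalk hb (i := 1) (by omega) hw
  have h01 : Γ.Adj (p 0) (p 1) := hp.1 0 (by omega)
  obtain ⟨z, hz, hzQ⟩ := SetLike.not_le_iff_exists.1 hp.2
  obtain ⟨r, hr⟩ := hL.exists_isArcCommutator hZ (b := 1) hb h01
  have hr' : IsVertexCommutator Γ (p 1) r := ⟨_, h01.symm, hr⟩
  have hcomm : ∀ z ∈ vertexCenter Γ G (p 0), ∀ q ∈ localKernel Γ G (p 1),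
      ⁅z, q⁆ = 1 ∨ ⁅z, q⁆ = r := fun z hz q hq =>
    hL.commutator_eq_one_or hZ (b := 1) hb h01 hr hz
      (arcStab_comm (G := G) (p 0) _ ▸ localKernel_le_arcStab h01.symm hq)
  have hrc : ∀ h ∈ stabilizer G (p 1), Commute r h := fun h hh =>
    hL.commute_of_isVertexCommutator hZ (b := 0) hb hr' hh
  have hZc : ⁅vertexCenter Γ G (p 0), localKernel Γ G (p 1)⁆ ≤
      Subgroup.centralizer (localKernel Γ G (p 1)) := by
    refine Subgroup.commutator_le.2 fun z hz q hq => ?_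
    rcases hcomm z hz q hq with h | h <;> rw [h]
    · exact one_mem _
    · exact Subgroup.mem_centralizer_iff.2 fun k hk => (hrc k hk.1).eq.symm
  rw [← Subgroup.commutator_eq_bot_iff_le_centralizer] at hZc
  have hM := Subgroup.commutator_commutator_eq_bot_of_rotate
    (by rwa [Subgroup.commutator_comm (localKernel Γ G (p 1))]) hZc
  rw [Subgroup.commutator_eq_bot_iff_le_centralizer] at hM
  refine ⟨z, vertexCenter_le_localKernel_of_adj (b := 0) hb h01.symm hz, hzQ,
    fun m hm => Subgroup.mem_centralizer_iff.1 (hM hm) z hz, r,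
    mem_arcCenter.2 ⟨localKernel_le_arcStab hw
      (hL.mem_localKernel_of_isVertexCommutator (b := 0) hb hr'), fun h hh =>
      hrc h (mem_arcStab.1 hh).1⟩, hcomm z hz⟩

lemma exists_mul_eq_of_mem_commutator (hw : Γ.Adj u w) {m : G}
    (hm : m ∈ ⁅localKernel Γ G u, localKernel Γ G u⁆) :
    ∃ k ∈ ⁅localKernel Γ G u ⊓ localKernel Γ G w, localKernel Γ G u ⊓ localKernel Γ G w⁆,
      ∃ c ∈ arcCenter G u w, k * c = m := by
  obtain ⟨z, hz, hzw, -, r, hr, hzr⟩ := hL.exists_mem_localKernel_commute_commutator hZ hb hw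
  set F := localKernel Γ G u ⊓ localKernel Γ G w with hF
  have hFP : F ≤ arcStab G u w := inf_le_left.trans (localKernel_le_arcStab hw)
  have hstep : ∀ x ∈ localKernel Γ G u, (∀ f ∈ F, ⁅f, x⁆ ∈ ⁅F, F⁆ ⊔ arcCenter G u w) →
      ∀ q ∈ localKernel Γ G u, ⁅q, x⁆ ∈ ⁅F, F⁆ ⊔ arcCenter G u w := by
    intro x hx hfx q hq
    obtain ⟨f, hf, rfl | rfl⟩ := hL.exists_eq_or_eq_mul hw hz hzw hq
    · exact hfx _ hf
    · have h1 : ⁅z, x⁆ ∈ arcCenter G u w := by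
        rcases hzr x hx with h | h <;> rw [h]
        exacts [one_mem _, hr]
      have h2 : ⁅f * z, x⁆ = ⁅z, x⁆ * ⁅f, x⁆ := by
        have := ((mem_arcCenter.1 h1).2 f (hFP hf)).eq
        calc ⁅f * z, x⁆ = f * ⁅z, x⁆ * (x * f⁻¹ * x⁻¹) := by simp [commutatorElement_def, mul_assoc]
          _ = ⁅z, x⁆ * ⁅f, x⁆ := by rw [← this]; simp [commutatorElement_def, mul_assoc]
      rw [h2]
      exact mul_mem (Subgroup.mem_sup_right h1) (hfx f hf)
  have hle : ⁅localKernel Γ G u, localKernel Γ G u⁆ ≤ ⁅F, F⁆ ⊔ arcCenter G u w := by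
    refine Subgroup.commutator_le.2 fun a ha c hc => hstep c hc (fun f hf => ?_) a ha
    rw [← commutatorElement_inv]
    refine inv_mem (hstep f hf.1 (fun f' hf' => ?_) c hc)
    exact Subgroup.mem_sup_left (Subgroup.commutator_mem_commutator hf' hf)
  have hFF : ⁅F, F⁆ ≤ arcStab G u w :=
    (Subgroup.commutator_mono inf_le_left inf_le_left).trans
      (commutator_le_localKernel.trans (localKernel_le_arcStab hw))
  have hr := MonoidHom.noncommCoprod_range (⁅F, F⁆).subtype (arcCenter G u w).subtype
    fun a c => ((mem_arcCenter.1 c.2).2 a (hFF a.2)).symm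
  rw [Subgroup.range_subtype, Subgroup.range_subtype] at hr
  obtain ⟨⟨k, c⟩, rfl⟩ := hr.symm ▸ hle hm
  exact ⟨k, k.2, c, c.2, rfl⟩

lemma commutator_commutator_le (hw : Γ.Adj u w) :
    ⁅⁅localKernel Γ G u, localKernel Γ G u⁆, localKernel Γ G u⁆ ≤
      ⁅⁅localKernel Γ G w, localKernel Γ G w⁆, localKernel Γ G w⁆ := by
  obtain ⟨z, hz, hzw, hzM, -⟩ := hL.exists_mem_localKernel_commute_commutator hZ hb hw
  refine Subgroup.commutator_le.2 fun m hm q hq => ?_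
  obtain ⟨f, hf, hfq⟩ := hL.exists_eq_or_eq_mul hw hz hzw hq
  have h1 : ⁅m, q⁆ = ⁅m, f⁆ := by
    rcases hfq with rfl | rfl
    exacts [rfl, commutatorElement_mul_right_of_commute (hzM m hm)]
  obtain ⟨k, hk, c, hc, rfl⟩ := hL.exists_mul_eq_of_mem_commutator hZ hb hw hm
  rw [h1, commutatorElement_mul_left_of_commute
    ((mem_arcCenter.1 hc).2 f (localKernel_le_arcStab hw hf.1))]
  exact Subgroup.commutator_mem_commutator (Subgroup.commutator_mono inf_le_right inf_le_right hk)
    hf.2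

lemma commute_of_mem_commutator {m : G} (hm : m ∈ ⁅localKernel Γ G u, localKernel Γ G u⁆)
    (hg : g ∈ localKernel Γ G u) : Commute m g := by
  obtain ⟨w, hw⟩ := hL.exists_adj u
  have he := (hL.commutator_commutator_le hZ hb hw).antisymm
    (hL.commutator_commutator_le hZ hb hw.symm)
  have hnorm : ∀ a, ∀ h ∈ stabilizer G a,
      ∀ k ∈ ⁅⁅localKernel Γ G a, localKernel Γ G a⁆, localKernel Γ G a⁆,
      h * k * h⁻¹ ∈ ⁅⁅localKernel Γ G a, localKernel Γ G a⁆, localKernel Γ G a⁆ :=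
    fun a h hh => conj_mem_commutator (conj_mem_commutator
      (fun k hk => hL.conj_mem_localKernel_of_mem hh hk)
      (fun k hk => hL.conj_mem_localKernel_of_mem hh hk))
      (fun k hk => hL.conj_mem_localKernel_of_mem hh hk)
  have hbot := hL.eq_bot_of_normalized hw
    ((Subgroup.commutator_mono commutator_le_localKernel le_rfl).trans
      (commutator_le_localKernel.trans (localKernel_le_arcStab hw)))
    (hnorm u) (he ▸ hnorm w)
  exact commutatorElement_eq_one_iff_commute.1
    (Subgroup.mem_bot.1 (hbot ▸ Subgroup.commutator_mem_commutator hm hg))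

lemma commute_of_mem_commutator_of_mem_stabilizer {m : G}
    (hm : m ∈ ⁅localKernel Γ G u, localKernel Γ G u⁆) (hg : g ∈ stabilizer G u) :
    Commute m g := by
  refine (Subgroup.mem_centralizer_singleton_iff.1
    (hL.stabilizer_le (H := Subgroup.centralizer {m}) (fun w hw => ?_) hg)).symm
  refine hL.arcStab_le_of_localKernel_le hZ hw (fun q hq => ?_) fun q hq => ?_
  · exact Subgroup.mem_centralizer_singleton_iff.2
      (hL.commute_of_mem_commutator hZ hb hm hq).eq.symm
  · obtain ⟨k, hk, c, hc, rfl⟩ := hL.exists_mul_eq_of_mem_commutator hZ hb hw hm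
    refine Subgroup.mem_centralizer_singleton_iff.2 (Commute.eq (Commute.symm ?_))
    exact (hL.commute_of_mem_commutator hZ hb
      (Subgroup.commutator_mono inf_le_right inf_le_right hk) hq).mul_left
      ((mem_arcCenter.1 hc).2 q
        (arcStab_comm (G := G) w u ▸ localKernel_le_arcStab hw.symm hq))

/-- If the critical length is two, the kernel of the arc is abelian. -/
lemma card_arcStab_le_of_length_two (hw : Γ.Adj u w) :
    Nat.card (arcStab G u w) ≤ 16 * Nat.card (arcCenter G u w) := by
  set F := localKernel Γ G u ⊓ localKernel Γ G w with hF
  have hFab : ∀ f ∈ F, ∀ f' ∈ F, Commute f f' := by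
    intro f hf f' hf'
    refine commutatorElement_eq_one_iff_commute.1 ?_
    have h1 := Subgroup.commutator_mem_commutator hf.1 hf'.1
    have h2 := Subgroup.commutator_mem_commutator hf.2 hf'.2
    exact hL.eq_one_of_commute hw
      (localKernel_le_arcStab hw (commutator_le_localKernel h1))
      (fun h hh => hL.commute_of_mem_commutator_of_mem_stabilizer hZ hb h1 hh)
      (fun h hh => hL.commute_of_mem_commutator_of_mem_stabilizer hZ hb h2 hh)
  have hindex : ∀ z r : G, (∀ f ∈ F, ⁅z, f⁆ = 1 ∨ ⁅z, f⁆ = r) →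
      ∀ a ∈ F, ∀ c ∈ F, a ∉ Subgroup.centralizer {z} → c ∉ Subgroup.centralizer {z} →
        a⁻¹ * c ∈ Subgroup.centralizer {z} := by
    intro z r hzr a ha c hc haz hcz
    have key : ∀ x ∈ F, x ∉ Subgroup.centralizer {z} → z * x = r * x * z := by
      intro x hx hxz
      rcases hzr x hx with h | h
      · exact absurd (Subgroup.mem_centralizer_singleton_iff.2
          (commutatorElement_eq_one_iff_commute.1 h).eq.symm) hxz
      · rw [← h]; simp [commutatorElement_def]
    have h1 := key a ha haz
    have h2 := key c hc hcz
    rw [Subgroup.mem_centralizer_singleton_iff]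
    have h3 : a⁻¹ * r⁻¹ * z = z * a⁻¹ := by
      rw [← mul_right_inj (r * a)]
      simp only [mul_assoc, mul_inv_cancel_left]
      rw [← mul_assoc a, ← mul_assoc r, ← mul_assoc r, ← h1]
      simp
    rw [← mul_assoc, ← h3, mul_assoc (a⁻¹ * r⁻¹), h2]
    simp [mul_assoc]
  obtain ⟨z, hz, hzw, -, r, -, hzr⟩ := hL.exists_mem_localKernel_commute_commutator hZ hb hw
  obtain ⟨y, hy, hyu, -, r', -, hyr⟩ := hL.exists_mem_localKernel_commute_commutator hZ hb hw.symm
  have := hL.finite_arcStab u w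
  have hFP : F ≤ arcStab G u w := inf_le_left.trans (localKernel_le_arcStab hw)
  have : Finite F := Finite.of_injective _ (Subgroup.inclusion_injective hFP)
  have : Finite (F ⊓ Subgroup.centralizer {z} : Subgroup G) :=
    Finite.of_injective _ (Subgroup.inclusion_injective (inf_le_left.trans hFP))
  have : Finite (arcCenter G u w) :=
    Finite.of_injective _ (Subgroup.inclusion_injective inf_le_left)
  have h1 := card_le_two_mul_card_inf (hindex z r fun f hf => hzr f hf.1)
  have h2 := card_le_two_mul_card_inf (X := F ⊓ Subgroup.centralizer {z})
    fun a ha c hc => hindex y r' (fun f hf => hyr f hf.2) a ha.1 c hc.1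
  have h3 : F ⊓ Subgroup.centralizer {z} ⊓ Subgroup.centralizer {y} ≤ arcCenter G u w := by
    rintro f ⟨⟨hf, hfz⟩, hfy⟩
    refine mem_arcCenter.2 ⟨hFP hf, fun k hk => (Subgroup.mem_centralizer_singleton_iff.1
      (hL.arcStab_le_of_localKernel_le (H := Subgroup.centralizer {f}) hZ hw ?_ ?_ hk)).symm⟩
    · intro q hq
      obtain ⟨f', hf', hq'⟩ := hL.exists_eq_or_eq_mul hw hz hzw hq
      refine Subgroup.mem_centralizer_singleton_iff.2 (Commute.eq ?_)
      rcases hq' with rfl | rfl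
      · exact hFab _ hf' _ hf
      · exact (hFab _ hf' _ hf).mul_left (Subgroup.mem_centralizer_singleton_iff.1 hfz).symm
    · intro q hq
      obtain ⟨f', hf', hq'⟩ := hL.exists_eq_or_eq_mul hw.symm hy hyu hq
      rw [inf_comm] at hf'
      refine Subgroup.mem_centralizer_singleton_iff.2 (Commute.eq ?_)
      rcases hq' with rfl | rfl
      · exact hFab _ hf' _ hf
      · exact (hFab _ hf' _ hf).mul_left (Subgroup.mem_centralizer_singleton_iff.1 hfy).symm
  have h4 := hL.card_arcStab_le hw
  rw [← hF] at h4
  have h5 := Subgroup.card_le_of_le h3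
  omega

end LengthTwo

/-- The order of an arc stabilizer is bounded in terms of the valency. -/
lemma card_arcStab_le_of_valency (hL : IsLocallyReflective Γ G) (hw : Γ.Adj u w)
    [Finite (Γ.neighborSet u)] [Finite (Γ.neighborSet w)] :
    Nat.card (arcStab G u w) ≤
      16 * (2 ^ Nat.card (Γ.neighborSet u) * 2 ^ Nat.card (Γ.neighborSet w)) := by
  by_cases hZ : ∀ a c, Γ.Adj a c → arcCenter G a c ≤ localKernel Γ G a
  · obtain ⟨b, hb⟩ := hL.exists_isCriticalLength u hZ
    have h1 := hL.card_arcCenter_le hZ hb hw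
    have h2 : Nat.card (arcStab G u w) ≤ 16 * Nat.card (arcCenter G u w) := by
      match b, hb with
      | 0, hb => have := hL.card_arcStab_le_of_length_one hZ hb hw; omega
      | 1, hb => exact hL.card_arcStab_le_of_length_two hZ hb hw
      | b + 2, hb => exact absurd hb (hL.not_isCriticalLength_add_three hZ u)
    omega
  · push Not at hZ
    obtain ⟨a, c, hac, hn⟩ := hZ
    obtain ⟨g, hg, hg'⟩ := hL.exists_smul_arc hac hw
    have h1 : ¬ arcCenter G u w ≤ localKernel Γ G u := by
      rw [← hg, ← hg']
      exact fun H => hn fun z hz => (hL.conj_mem_localKernel_iff g).1 (H (conj_mem_arcCenter g hz))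
    have h2 := hL.card_arcStab_le_four hw h1
    have h3 : 0 < 2 ^ Nat.card (Γ.neighborSet u) * 2 ^ Nat.card (Γ.neighborSet w) := by positivity
    omega

lemma card_stabilizer_le (hL : IsLocallyReflective Γ G) {N : ℕ}
    (hN : ∀ u, Finite (Γ.neighborSet u) ∧ Nat.card (Γ.neighborSet u) = N) (u : α) :
    Nat.card (stabilizer G u) ≤ N * (16 * (2 ^ N * 2 ^ N)) := by
  obtain ⟨w, hw⟩ := hL.exists_adj u
  have := (hN u).1
  have := (hN w).1
  have := hL.finite_stabilizer u
  have := hL.finite_arcStab u w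
  have h1 := hL.card_arcStab_le_of_valency hw
  rw [(hN u).2, (hN w).2] at h1
  choose! f hf hfw using fun (x : α) (hx : Γ.Adj u x) =>
    hL.exists_smul_eq hx hw (H := ⊤) le_top le_top
  let F : stabilizer G u → Γ.neighborSet u × arcStab G u w := fun g =>
    (⟨g.1 • w, hL.adj_smul_right g.2 hw⟩,
      ⟨f (g.1 • w) * g.1, by
        have := hfw _ (hL.adj_smul_right g.2 hw)
        rw [mem_arcStab, mul_smul, mul_smul, mem_stabilizer_iff.1 g.2]
        exact this⟩)
  have hF : Function.Injective F := by
    rintro ⟨g, hg⟩ ⟨g', hg'⟩ h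
    have e1 : g • w = g' • w := congrArg (fun x => (x.1 : α)) h
    have e2 : f (g • w) * g = f (g' • w) * g' := congrArg (fun x => (x.2 : G)) h
    rw [e1] at e2
    exact Subtype.ext (mul_left_cancel e2)
  calc Nat.card (stabilizer G u) ≤ Nat.card (Γ.neighborSet u × arcStab G u w) :=
        Nat.card_le_card_of_injective F hF
    _ ≤ _ := by rw [Nat.card_prod, (hN u).2]; exact Nat.mul_le_mul_left _ h1

end IsLocallyReflective

lemma exists_eq_or_eq_of_mem_Lgrp {n : ℕ} {l : Equiv.Perm (Vec n)} (hl : l ∈ Lgrp n) :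
    ∃ c, (∀ v, l v = v + c) ∨ ∀ v, l v = -v + c := by
  induction hl using Subgroup.closure_induction with
  | mem x hx =>
    rcases hx with ⟨w, hw⟩ | rfl
    exacts [⟨w, .inl hw⟩, ⟨0, .inr fun v => by simp⟩]
  | one => exact ⟨0, .inl fun v => by simp⟩
  | mul x y _ _ hx hy =>
    obtain ⟨c, hx | hx⟩ := hx <;> obtain ⟨d, hy | hy⟩ := hy
    · exact ⟨d + c, .inl fun v => by simp [hx, hy, add_assoc]⟩
    · exact ⟨d + c, .inr fun v => by simp [hx, hy, add_assoc]⟩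
    · exact ⟨-d + c, .inr fun v => by simp [hx, hy]; abel⟩
    · exact ⟨-d + c, .inl fun v => by simp [hx, hy]; abel⟩
  | inv x _ hx =>
    obtain ⟨c, hx | hx⟩ := hx
    · exact ⟨-c, .inl fun v => by rw [Equiv.Perm.inv_eq_iff_eq, hx]; abel⟩
    · exact ⟨c, .inr fun v => by rw [Equiv.Perm.inv_eq_iff_eq, hx]; abel⟩

lemma reflection_of_mem_Lgrp {n : ℕ} {l : Equiv.Perm (Vec n)} (hl : l ∈ Lgrp n) {a : Vec n}
    (ha : l a = a) : (∀ v, l v = v) ∨ ∀ v, l v = -v + (a + a) := by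
  obtain ⟨c, h | h⟩ := exists_eq_or_eq_of_mem_Lgrp hl
  · have : c = 0 := by simpa [h] using ha
    exact .inl fun v => by simp [h, this]
  · have : c = a + a := neg_add_eq_iff_eq_add.1 ((h a).symm.trans ha)
    exact .inr fun v => by rw [h, this]

lemma exists_reflection_mem_Lgrp {n : ℕ} (a : Vec n) :
    ∃ l ∈ Lgrp n, ∀ v, l v = -v + (a + a) :=
  ⟨Equiv.addRight (a + a) * Equiv.neg (Vec n),
    mul_mem (Subgroup.subset_closure (.inl ⟨a + a, fun _ => rfl⟩))
      (Subgroup.subset_closure (.inr rfl)), fun _ => rfl⟩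

lemma isLocallyReflective_of_locallyL {n : ℕ} (hn : 1 ≤ n) {α : Type*} {Γ : SimpleGraph α}
    {G : Type*} [Group G] [MulAction G α] (hconn : Γ.Connected)
    (hadj : ∀ (g : G) (u w : α), Γ.Adj u w ↔ Γ.Adj (g • u) (g • w))
    (hfaith : ∀ g : G, (∀ u : α, g • u = u) → g = 1)
    (htrans : ∀ u w : α, ∃ g : G, g • u = w) (hfin : ∀ u : α, Finite (stabilizer G u))
    (hL : LocallyL n Γ G) : IsLocallyReflective Γ G := by
  have key : ∀ u, ∃ φ : Γ.neighborSet u ≃ Vec n,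
      (∀ w (hw : Γ.Adj u w), ∀ p ∈ arcStab G u w, p ∉ localKernel Γ G u →
        ∀ z (hz : Γ.Adj u z), ∃ hz' : Γ.Adj u (p • z),
          φ ⟨p • z, hz'⟩ = -φ ⟨z, hz⟩ + (φ ⟨w, hw⟩ + φ ⟨w, hw⟩)) ∧
      ∀ w (hw : Γ.Adj u w), ∃ p ∈ arcStab G u w, p ∉ localKernel Γ G u := by
    intro u
    obtain ⟨φ, h1, h2⟩ := hL u
    refine ⟨φ, fun w hw p hp hpQ => ?_, fun w hw => ?_⟩
    · rw [mem_arcStab] at hp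
      obtain ⟨l, hl, hpl⟩ := h1 p hp.1
      have hlw : l (φ ⟨w, hw⟩) = φ ⟨w, hw⟩ := by
        obtain ⟨hz, h⟩ := hpl ⟨w, hw⟩
        rw [← h]
        exact congrArg φ (Subtype.ext hp.2)
      rcases reflection_of_mem_Lgrp hl hlw with h | h
      · refine absurd (mem_localKernel.2 ⟨hp.1, fun z hz => ?_⟩) hpQ
        obtain ⟨hz', h'⟩ := hpl ⟨z, hz⟩
        rw [h] at h'
        exact congrArg Subtype.val (φ.injective h')
      · intro z hz
        obtain ⟨hz', h'⟩ := hpl ⟨z, hz⟩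
        exact ⟨hz', h'.trans (h _)⟩
    · obtain ⟨l, hl, hlv⟩ := exists_reflection_mem_Lgrp (φ ⟨w, hw⟩)
      obtain ⟨p, hp, hpl⟩ := h2 l hl
      refine ⟨p, mem_arcStab.2 ⟨hp, ?_⟩, fun hpQ => ?_⟩
      · obtain ⟨hz, h⟩ := hpl ⟨w, hw⟩
        rw [hlv, neg_add_cancel_left] at h
        exact congrArg Subtype.val (φ.injective h)
      · have hid : ∀ v, l v = v := by
          intro v
          obtain ⟨⟨z, hz⟩, rfl⟩ := φ.surjective v
          obtain ⟨hz', h⟩ := hpl ⟨z, hz⟩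
          rw [← h]
          exact congrArg φ (Subtype.ext ((mem_localKernel.1 hpQ).2 z hz))
        have e0 := hid 0
        have e1 := hid fun _ => 1
        rw [hlv] at e0 e1
        rw [neg_zero, zero_add] at e0
        rw [e0] at e1
        have := congrFun e1 ⟨0, hn⟩
        simp only [Pi.add_apply, Pi.neg_apply, Pi.zero_apply] at this
        exact absurd this (by decide)
  refine ⟨hconn, hadj, hfaith, htrans, hfin, fun u => ?_, fun u w hw => ?_,
    fun u w w' hw hw' s hs t ht hsQ htQ => ?_, fun u w hw p hp q hq hpQ hqQ => ?_⟩
  · obtain ⟨φ, -⟩ := hL u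
    exact ⟨φ.symm 0, (φ.symm 0).2⟩
  · obtain ⟨φ, -, h⟩ := key u
    exact h w hw
  · obtain ⟨φ, h, -⟩ := key u
    obtain ⟨h1, h2⟩ := h w' hw' t ht htQ w hw
    obtain ⟨h3, h4⟩ := h w hw s hs hsQ _ h1
    rw [mul_smul]
    refine congrArg Subtype.val (φ.injective (a₁ := ⟨_, h3⟩) (a₂ := ⟨w', hw'⟩) ?_)
    rw [h4, h2]
    have h3 : ∀ x y : ZMod 3, -(-x + (y + y)) + (x + x) = y := by decide
    exact funext fun i => h3 _ _
  · obtain ⟨φ, h, -⟩ := key u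
    refine mem_localKernel.2 ⟨?_, fun z hz => ?_⟩
    · rw [mul_smul, (mem_arcStab.1 hq).1, inv_smul_eq_iff, (mem_arcStab.1 hp).1]
    · rw [mul_smul, inv_smul_eq_iff]
      obtain ⟨h1, h2⟩ := h w hw p hp hpQ z hz
      obtain ⟨h3, h4⟩ := h w hw q hq hqQ z hz
      exact congrArg Subtype.val (φ.injective (h4.trans h2.symm))

/-- the Frobenius group `L` of order `2·3^n` and degree `3^n` with
elementary abelian Frobenius kernel (`n ≥ 1`) is graph-restrictive. -/
theorem Lgrp_graph_restrictive (n : ℕ) (hn : 1 ≤ n) :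
    ∃ C : ℕ, ∀ (α : Type) (Γ : SimpleGraph α) (G : Type) [Group G] [MulAction G α],
      Γ.Connected →
      (∀ (g : G) (u w : α), Γ.Adj u w ↔ Γ.Adj (g • u) (g • w)) →
      (∀ g : G, (∀ u : α, g • u = u) → g = 1) →
      (∀ u w : α, ∃ g : G, g • u = w) →
      (∀ u : α, Finite (stabilizer G u)) →
      LocallyL n Γ G →
      ∀ x : α, Nat.card (stabilizer G x) ≤ C := by
  refine ⟨3 ^ n * (16 * (2 ^ 3 ^ n * 2 ^ 3 ^ n)),
    fun α Γ G _ _ hconn hadj hfaith htrans hfin hL x => ?_⟩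
  refine (isLocallyReflective_of_locallyL hn hconn hadj hfaith htrans hfin hL).card_stabilizer_le
    (fun u => ?_) x
  obtain ⟨φ, -⟩ := hL u
  exact ⟨Finite.of_equiv _ φ.symm, by rw [Nat.card_congr φ, Nat.card_fun]; simp⟩
end

section
/- The group L is semiprimitive in its action on V: every normal subgroup of L is either transitive on V or semiregular on V (i.e., all of its point stabilizers are trivial). In fact, every proper normal subgroup of L is contained in the translation subgroup V (elementary abelian of order 3^m for some m) and is semiregular on V. -/
open MulAction Pointwise

theorem addRight_mem_Lgrp {n : ℕ} (w : Vec n) : Equiv.addRight w ∈ Lgrp n :=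
  Subgroup.subset_closure (Or.inl ⟨w, fun _ => rfl⟩)

/-- Every element of `L` is a translation or a point reflection. -/
theorem translation_or_reflection_of_mem_Lgrp {n : ℕ} {f : Equiv.Perm (Vec n)}
    (hf : f ∈ Lgrp n) : (∃ w, ∀ v, f v = v + w) ∨ ∃ w, ∀ v, f v = -v + w := by
  induction hf using Subgroup.closure_induction with
  | mem f hf =>
    rcases hf with hf | rfl
    · exact Or.inl hf
    · exact Or.inr ⟨0, fun v => by simp⟩
  | one => exact Or.inl ⟨0, fun v => by simp⟩
  | mul f g _ _ hf hg =>
    rcases hf with ⟨a, ha⟩ | ⟨a, ha⟩ <;> rcases hg with ⟨b, hb⟩ | ⟨b, hb⟩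
    · exact Or.inl ⟨b + a, fun v => by rw [Equiv.Perm.mul_apply, ha, hb]; abel⟩
    · exact Or.inr ⟨b + a, fun v => by rw [Equiv.Perm.mul_apply, ha, hb]; abel⟩
    · exact Or.inr ⟨-b + a, fun v => by rw [Equiv.Perm.mul_apply, ha, hb]; abel⟩
    · exact Or.inl ⟨-b + a, fun v => by rw [Equiv.Perm.mul_apply, ha, hb]; abel⟩
  | inv f _ hf =>
    rcases hf with ⟨a, ha⟩ | ⟨a, ha⟩
    · exact Or.inl ⟨-a, fun v => by rw [Equiv.Perm.inv_eq_iff_eq, ha]; abel⟩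
    · exact Or.inr ⟨a, fun v => by rw [Equiv.Perm.inv_eq_iff_eq, ha]; abel⟩

/-- A normal subgroup of `L` containing a point reflection is all of `L`. -/
theorem eq_top_of_reflection_mem {n : ℕ} {N : Subgroup (Lgrp n)} (hN : N.Normal)
    {g : Lgrp n} (hg : g ∈ N) {w : Vec n} (hw : ∀ v, (g : Equiv.Perm (Vec n)) v = -v + w) :
    N = ⊤ := by
  have reflection_mem (f : Lgrp n) (c : Vec n)
      (hf : ∀ v, (f : Equiv.Perm (Vec n)) v = -v + c) : f ∈ N := by
    let t : Lgrp n := ⟨Equiv.addRight (w - c), addRight_mem_Lgrp _⟩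
    have h3 (x : Vec n) : x + x + x = 0 := by
      ext i
      exact (by decide : ∀ y : ZMod 3, y + y + y = 0) (x i)
    have heq : t * g * t⁻¹ = f := by
      rw [mul_inv_eq_iff_eq_mul]
      ext1
      refine Equiv.ext fun v => ?_
      change (g : Equiv.Perm (Vec n)) v + (w - c) = (f : Equiv.Perm (Vec n)) (v + (w - c))
      rw [hw, hf, ← sub_eq_zero, ← h3 (w - c)]
      abel
    exact heq ▸ hN.conj_mem g hg t
  refine eq_top_iff.2 fun f _ => ?_
  rcases translation_or_reflection_of_mem_Lgrp f.2 with ⟨a, ha⟩ | ⟨a, ha⟩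
  · refine (N.mul_mem_cancel_right hg).1 (reflection_mem (f * g) (w + a) fun v => ?_)
    rw [Subgroup.coe_mul, Equiv.Perm.mul_apply, ha, hw, add_assoc]
  · exact reflection_mem f a ha

/-- `L` is semiprimitive on `V`: every normal subgroup is transitive or
semiregular; in fact every proper normal subgroup consists of translations and is
semiregular. -/
theorem Lgrp_semiprimitive (n : ℕ) (hn : 2 ≤ n)
    (N : Subgroup ↥(Lgrp n)) (hN : N.Normal) :
    ((∀ u v : Vec n, ∃ g ∈ N, ((g : ↥(Lgrp n)) : Equiv.Perm (Vec n)) u = v) ∨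
      (∀ g ∈ N, ∀ v : Vec n, ((g : ↥(Lgrp n)) : Equiv.Perm (Vec n)) v = v → g = 1)) ∧
    (N ≠ ⊤ →
      (∀ g ∈ N, ((g : ↥(Lgrp n)) : Equiv.Perm (Vec n)) ∈ TransGrp n) ∧
      (∀ g ∈ N, ∀ v : Vec n, ((g : ↥(Lgrp n)) : Equiv.Perm (Vec n)) v = v → g = 1)) := by
  have translation (hne : N ≠ ⊤) (g : Lgrp n) (hg : g ∈ N) :
      ∃ w, ∀ v, (g : Equiv.Perm (Vec n)) v = v + w :=
    (translation_or_reflection_of_mem_Lgrp g.2).resolve_right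
      fun ⟨_, hw⟩ => hne (eq_top_of_reflection_mem hN hg hw)
  have semiregular (hne : N ≠ ⊤) (g : Lgrp n) (hg : g ∈ N) (v : Vec n)
      (hv : (g : Equiv.Perm (Vec n)) v = v) : g = 1 := by
    obtain ⟨w, hw⟩ := translation hne g hg
    have hw0 : w = 0 := by simpa [hw] using hv
    ext1
    exact Equiv.ext fun x => by simp [hw, hw0]
  refine ⟨?_, fun hne => ⟨fun g hg => Subgroup.subset_closure (translation hne g hg),
    semiregular hne⟩⟩
  by_cases htop : N = ⊤
  · subst htop
    exact Or.inl fun u v => ⟨⟨Equiv.addRight (v - u), addRight_mem_Lgrp _⟩, Subgroup.mem_top _,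
      by simp⟩
  · exact Or.inr (semiregular htop)
end

section
/- Every irreducible 𝔽₂L-module on which L acts nontrivially has dimension 2 over 𝔽₂. That is, if W is a finite-dimensional vector space over the field with 2 elements equipped with a linear L-action such that W is simple as a module over the group algebra 𝔽₂[L] and some element of L acts nontrivially on W, then dim_{𝔽₂} W = 2. -/
open MulAction Pointwise

section Generic

variable {G W : Type*} [Group G] [AddCommGroup W] [Module (ZMod 2) W] [DistribMulAction G W]

theorem add_self_eq_zero_of_module_zmod_two (x : W) : x + x = 0 := by
  rw [← two_smul (ZMod 2) x, show (2 : ZMod 2) = 0 from rfl, zero_smul]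

theorem eq_of_add_eq_zero_of_module_zmod_two {x y : W} (h : x + y = 0) : x = y := by
  rw [eq_neg_of_add_eq_zero_left h, neg_eq_of_add_eq_zero_left
    (add_self_eq_zero_of_module_zmod_two y)]

/-- The subspace of vectors fixed by a group element. -/
def fixedSubspace (W : Type*) [AddCommGroup W] [Module (ZMod 2) W] [DistribMulAction G W]
    [SMulCommClass G (ZMod 2) W] (g : G) : Submodule (ZMod 2) W where
  carrier := {x | g • x = x}
  add_mem' {x y} hx hy := by
    change g • x = x at hx
    change g • y = y at hy
    change g • (x + y) = x + y
    rw [smul_add, hx, hy]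
  zero_mem' := smul_zero g
  smul_mem' c x hx := by
    change g • x = x at hx
    change g • c • x = c • x
    rw [smul_comm, hx]

theorem exists_ne_zero_smul_eq_of_mul_self_eq_one [Nontrivial W] {s : G} (hs : s * s = 1) :
    ∃ w : W, w ≠ 0 ∧ s • w = w := by
  obtain ⟨x, hx⟩ := exists_ne (0 : W)
  by_cases h : x + s • x = 0
  · exact ⟨x, hx, (eq_of_add_eq_zero_of_module_zmod_two h).symm⟩
  · exact ⟨x + s • x, h, by rw [smul_add, smul_smul, hs, one_smul, add_comm]⟩

/-- A nontrivial irreducible module in characteristic 2 for a generalized dihedral group over an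
abelian group of exponent 3 has dimension 2. -/
theorem finrank_eq_two_of_irreducible_generalized_dihedral [SMulCommClass G (ZMod 2) W]
    (H : Subgroup G) (s : G)
    (hcomm : ∀ a ∈ H, ∀ b ∈ H, a * b = b * a) (hcube : ∀ a ∈ H, a ^ 3 = 1)
    (hss : s * s = 1) (hinv : ∀ a ∈ H, s * a = a⁻¹ * s)
    (hG : ∀ g, g ∈ H ∨ ∃ a ∈ H, g = a * s)
    (hirr : ∀ U : Submodule (ZMod 2) W,
      (∀ (g : G) (w : W), w ∈ U → g • w ∈ U) → U = ⊥ ∨ U = ⊤)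
    (hnt : ∃ (g : G) (w : W), g • w ≠ w) :
    Module.finrank (ZMod 2) W = 2 := by
  have hirr' : ∀ U : Submodule (ZMod 2) W, (∀ a ∈ H, ∀ w ∈ U, a • w ∈ U) →
      (∀ w ∈ U, s • w ∈ U) → U = ⊥ ∨ U = ⊤ := by
    refine fun U hH hs => hirr U fun g w hw => ?_
    rcases hG g with hg | ⟨a, ha, rfl⟩
    · exact hH g hg w hw
    · rw [mul_smul]
      exact hH a ha _ (hs w hw)
  have : Nontrivial W := by
    obtain ⟨g, w, h⟩ := hnt
    exact ⟨_, _, h⟩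
  obtain ⟨w, hw0, hsw⟩ := exists_ne_zero_smul_eq_of_mul_self_eq_one (W := W) hss
  have hfix : ∀ a ∈ H, (∀ x : W, a • x = x → x = 0) ∨ ∀ x : W, a • x = x := by
    intro a ha
    refine (hirr' (fixedSubspace W a) ?_ ?_).imp (fun h x hx => ?_) (fun h x => ?_)
    · intro b hb x (hx : a • x = x)
      change a • b • x = b • x
      rw [smul_smul, hcomm a ha b hb, mul_smul, hx]
    · intro x (hx : a • x = x)
      change a • s • x = s • x
      have : a * s = s * a⁻¹ := by rw [hinv _ (inv_mem ha), inv_inv]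
      rw [smul_smul, this, mul_smul, inv_smul_eq_iff.mpr hx.symm]
    · exact (Submodule.mem_bot (ZMod 2)).mp (h ▸ (hx : x ∈ fixedSubspace W a))
    · exact (h ▸ Submodule.mem_top : x ∈ fixedSubspace W a)
  have hsq : ∀ a ∈ H, a * a = a⁻¹ := fun a ha => by
    rw [eq_inv_iff_mul_eq_one, ← hcube a ha, pow_succ, pow_two]
  have hnorm : ∀ a ∈ H, (∀ x : W, a • x = x → x = 0) →
      ∀ x : W, x + a • x + a⁻¹ • x = 0 := by
    intro a ha h x
    refine h _ ?_
    rw [smul_add, smul_add, smul_smul, hsq a ha, smul_inv_smul]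
    abel
  by_cases htriv : ∀ a ∈ H, ∀ x : W, a • x = x
  · have hs : fixedSubspace W s = ⊤ := by
      refine (hirr' (fixedSubspace W s) ?_ ?_).resolve_left fun h => hw0 ?_
      · intro a ha x hx
        rwa [htriv a ha x]
      · intro x (hx : s • x = x)
        rwa [hx]
      · exact (Submodule.mem_bot (ZMod 2)).mp (h ▸ (hsw : w ∈ fixedSubspace W s))
    obtain ⟨g, x, hgx⟩ := hnt
    rcases hG g with hg | ⟨a, ha, rfl⟩
    · exact absurd (htriv g hg x) hgx
    · refine absurd ?_ hgx
      rw [mul_smul, htriv a ha]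
      exact (hs ▸ Submodule.mem_top : x ∈ fixedSubspace W s)
  push Not at htriv
  obtain ⟨t, ht, y, hty⟩ := htriv
  have htfree := (hfix t ht).resolve_right fun h => hty (h y)
  have htnorm := hnorm t ht htfree
  have hcases : ∀ a ∈ H, (∀ x : W, a • x = x) ∨ (∀ x : W, a • x = t • x) ∨
      ∀ x : W, a • x = t⁻¹ • x := by
    intro a ha
    rcases hfix a ha with hafree | h
    · right
      rcases hfix (t⁻¹ * a) (mul_mem (inv_mem ht) ha) with h1 | h1
      · right
        intro x
        have hprod : (t⁻¹ * a) • (a • x + t⁻¹ • x) = a • x + t⁻¹ • x := by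
          have htt : t⁻¹ * t⁻¹ = t := by rw [hsq _ (inv_mem ht), inv_inv]
          have e1 : (t⁻¹ * a) • a • x = t⁻¹ • a⁻¹ • x := by
            rw [smul_smul, mul_assoc, hsq a ha, mul_smul]
          have e2 : (t⁻¹ * a) • t⁻¹ • x = t • a • x := by
            rw [smul_smul, mul_assoc, hcomm a ha _ (inv_mem ht), ← mul_assoc, htt, mul_smul]
          apply eq_of_add_eq_zero_of_module_zmod_two
          have n1 := htnorm (a • x)
          have n2 := congrArg (t⁻¹ • ·) (hnorm a ha hafree x)
          simp only [smul_add, smul_zero] at n2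
          have d := add_self_eq_zero_of_module_zmod_two (t⁻¹ • a • x)
          rw [smul_add, e1, e2]
          calc _ = (a • x + t • a • x + t⁻¹ • a • x)
                + (t⁻¹ • x + t⁻¹ • a • x + t⁻¹ • a⁻¹ • x)
                - (t⁻¹ • a • x + t⁻¹ • a • x) := by abel
            _ = 0 := by rw [n1, n2, d]; simp
        exact eq_of_add_eq_zero_of_module_zmod_two (h1 _ hprod)
      · left
        intro x
        have := h1 x
        rwa [mul_smul, inv_smul_eq_iff] at this
    · exact Or.inl h
  have htw : t⁻¹ • w = w + t • w :=
    (eq_of_add_eq_zero_of_module_zmod_two (htnorm w)).symm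
  have httw : t • t • w = w + t • w := by
    have := congrArg (t • ·) htw
    simp only [smul_inv_smul, smul_add] at this
    rw [← sub_eq_iff_eq_add'.mpr this, ← add_zero (w - t • w),
      ← add_self_eq_zero_of_module_zmod_two (t • w)]
    abel
  have hspan : Submodule.span (ZMod 2) (Set.range ![w, t • w]) = ⊤ := by
    set U := Submodule.span (ZMod 2) (Set.range ![w, t • w]) with hU
    have hwU : w ∈ U := Submodule.subset_span ⟨0, rfl⟩
    have htU : t • w ∈ U := Submodule.subset_span ⟨1, rfl⟩
    have hstable : ∀ g : G, g • w ∈ U → g • t • w ∈ U → ∀ x ∈ U, g • x ∈ U := by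
      intro g h0 h1 x hx
      refine Submodule.span_induction (p := fun x _ => g • x ∈ U) ?_ ?_ ?_ ?_ hx
      · rintro _ ⟨i, rfl⟩
        fin_cases i
        · exact h0
        · exact h1
      · rw [smul_zero]; exact U.zero_mem
      · intro x y _ _ hx hy
        rw [smul_add]; exact U.add_mem hx hy
      · intro c x _ hx
        rw [smul_comm]; exact U.smul_mem c hx
    refine (hirr' U ?_ ?_).resolve_left fun h => hw0 ?_
    · intro a ha x hx
      rcases hcases a ha with h | h | h
      · rwa [h]
      · rw [h]
        exact hstable t htU (httw ▸ U.add_mem hwU htU) x hx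
      · rw [h]
        exact hstable t⁻¹ (htw ▸ U.add_mem hwU htU) (by rwa [inv_smul_smul]) x hx
    · refine hstable s (by rwa [hsw]) ?_
      rw [smul_smul, hinv t ht, mul_smul, hsw, htw]
      exact U.add_mem hwU htU
    · exact (Submodule.mem_bot (ZMod 2)).mp (h ▸ hwU)
  have hli : LinearIndependent (ZMod 2) ![w, t • w] := by
    rw [LinearIndependent.pair_iff]
    have htw0 : t • w ≠ 0 := fun h => hw0 ((smul_eq_zero_iff_eq t).mp h)
    have hne : w + t • w ≠ 0 := fun h =>
      hw0 (htfree w (eq_of_add_eq_zero_of_module_zmod_two h).symm)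
    have h2 : ∀ c : ZMod 2, c = 0 ∨ c = 1 := by decide
    intro c d h
    rcases h2 c with rfl | rfl <;> rcases h2 d with rfl | rfl <;>
      simp only [zero_smul, one_smul, zero_add, add_zero] at h
    · exact ⟨rfl, rfl⟩
    · exact absurd h htw0
    · exact absurd h hw0
    · exact absurd h hne
  rw [Module.finrank_eq_card_basis (Module.Basis.mk hli hspan.ge), Fintype.card_fin]

end Generic

theorem mem_TransGrp_iff {n : ℕ} {f : Equiv.Perm (Vec n)} :
    f ∈ TransGrp n ↔ ∃ w, ∀ v, f v = v + w := by
  refine ⟨fun hf => ?_, fun hf => Subgroup.subset_closure hf⟩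
  induction hf using Subgroup.closure_induction with
  | mem f hf => exact hf
  | one => exact ⟨0, fun v => (add_zero v).symm⟩
  | mul f g _ _ hf hg =>
    obtain ⟨a, ha⟩ := hf
    obtain ⟨b, hb⟩ := hg
    exact ⟨b + a, fun v => by rw [Equiv.Perm.mul_apply, ha, hb, add_assoc]⟩
  | inv f _ hf =>
    obtain ⟨a, ha⟩ := hf
    exact ⟨-a, fun v => by rw [Equiv.Perm.inv_eq_iff_eq, ha, neg_add_cancel_right]⟩

theorem neg_mem_Lgrp (n : ℕ) : Equiv.neg (Vec n) ∈ Lgrp n :=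
  Subgroup.subset_closure (Or.inr rfl)

theorem neg_mul_eq_inv_mul_neg {n : ℕ} {a : Equiv.Perm (Vec n)} (ha : a ∈ TransGrp n) :
    Equiv.neg (Vec n) * a = a⁻¹ * Equiv.neg (Vec n) := by
  obtain ⟨w, hw⟩ := mem_TransGrp_iff.mp ha
  rw [eq_inv_mul_iff_mul_eq]
  ext1 v
  simp [hw]

theorem neg_mul_neg_eq_one (n : ℕ) : Equiv.neg (Vec n) * Equiv.neg (Vec n) = 1 := by
  ext1 v
  simp

theorem mem_TransGrp_or_of_mem_Lgrp {n : ℕ} {f : Equiv.Perm (Vec n)} (hf : f ∈ Lgrp n) :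
    f ∈ TransGrp n ∨ ∃ a ∈ TransGrp n, f = a * Equiv.neg (Vec n) := by
  induction hf using Subgroup.closure_induction with
  | mem f hf =>
    rcases hf with hf | rfl
    · exact Or.inl (mem_TransGrp_iff.mpr hf)
    · exact Or.inr ⟨1, one_mem _, (one_mul _).symm⟩
  | one => exact Or.inl (one_mem _)
  | mul f g _ _ hf hg =>
    rcases hf with hf | ⟨a, ha, rfl⟩ <;> rcases hg with hg | ⟨b, hb, rfl⟩
    · exact Or.inl (mul_mem hf hg)
    · exact Or.inr ⟨f * b, mul_mem hf hb, (mul_assoc _ _ _).symm⟩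
    · exact Or.inr ⟨a * g⁻¹, mul_mem ha (inv_mem hg), by
        rw [mul_assoc, neg_mul_eq_inv_mul_neg hg, mul_assoc]⟩
    · refine Or.inl ?_
      rw [mul_assoc, ← mul_assoc _ b, neg_mul_eq_inv_mul_neg hb, mul_assoc b⁻¹,
        neg_mul_neg_eq_one, mul_one]
      exact mul_mem ha (inv_mem hb)
  | inv f _ hf =>
    rcases hf with hf | ⟨a, ha, rfl⟩
    · exact Or.inl (inv_mem hf)
    · refine Or.inr ⟨a, ha, ?_⟩
      rw [mul_inv_rev, inv_eq_of_mul_eq_one_right (neg_mul_neg_eq_one n),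
        neg_mul_eq_inv_mul_neg (inv_mem ha), inv_inv]

/-- every irreducible `𝔽₂L`-module on which `L` acts nontrivially has
dimension 2 over `𝔽₂`. -/
theorem nontrivial_irreducible_F2L_module_finrank_eq_two (n : ℕ) (hn : 2 ≤ n)
    (W : Type*) [AddCommGroup W] [Module (ZMod 2) W] [FiniteDimensional (ZMod 2) W]
    [DistribMulAction ↥(Lgrp n) W] [SMulCommClass ↥(Lgrp n) (ZMod 2) W]
    (hirr : ∀ U : Submodule (ZMod 2) W,
      (∀ (g : ↥(Lgrp n)) (w : W), w ∈ U → g • w ∈ U) → U = ⊥ ∨ U = ⊤)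
    (hnt : ∃ (g : ↥(Lgrp n)) (w : W), g • w ≠ w) :
    Module.finrank (ZMod 2) W = 2 := by
  refine finrank_eq_two_of_irreducible_generalized_dihedral ((TransGrp n).subgroupOf (Lgrp n))
    ⟨Equiv.neg (Vec n), neg_mem_Lgrp n⟩ ?_ ?_ ?_ ?_ ?_ hirr hnt
  · intro a ha b hb
    obtain ⟨u, hu⟩ := mem_TransGrp_iff.mp (Subgroup.mem_subgroupOf.mp ha)
    obtain ⟨v, hv⟩ := mem_TransGrp_iff.mp (Subgroup.mem_subgroupOf.mp hb)
    ext1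
    ext1 x
    simp only [Subgroup.coe_mul, Equiv.Perm.mul_apply, hu, hv, add_right_comm]
  · intro a ha
    obtain ⟨u, hu⟩ := mem_TransGrp_iff.mp (Subgroup.mem_subgroupOf.mp ha)
    have hu3 : u + u + u = 0 := by
      ext i
      exact (by decide : ∀ c : ZMod 3, c + c + c = 0) (u i)
    ext1
    ext1 x
    simp only [Subgroup.coe_mul, pow_succ, pow_zero, one_mul, Equiv.Perm.mul_apply, hu,
      Subgroup.coe_one, Equiv.Perm.one_apply]
    rw [add_assoc, add_assoc, ← add_assoc u, hu3, add_zero]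
  · exact Subtype.ext (neg_mul_neg_eq_one n)
  · exact fun a ha => Subtype.ext (neg_mul_eq_inv_mul_neg (Subgroup.mem_subgroupOf.mp ha))
  · intro g
    refine (mem_TransGrp_or_of_mem_Lgrp g.2).imp Subgroup.mem_subgroupOf.mpr ?_
    rintro ⟨a, ha, hga⟩
    have haL : a ∈ Lgrp n := Subgroup.closure_mono Set.subset_union_left ha
    exact ⟨⟨a, haL⟩, Subgroup.mem_subgroupOf.mpr ha, Subtype.ext hga⟩
end

section
/- For the edge e = {x,y}: the setwise edge stabilizer G_e is a 2-group, the quotient G_e/G_{xy}^{[1]} is isomorphic to the dihedral group of order 8, and G_x^{[1]}·G_y^{[1]} = G_x ∩ G_y. -/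
open MulAction Pointwise

/-- A group generated by `r` of order 4 and an involution `s` inverting `r` is
dihedral of order 8. -/
theorem nonempty_mulEquiv_dihedralGroup_four {Q : Type*} [Group Q] (r s : Q)
    (hr : r ^ 4 = 1) (hs : s * s = 1) (hsr : s * r * s * r = 1) (hr2 : r ^ 2 ≠ 1)
    (hgen : ∀ q : Q, ∃ i : ℕ, q = r ^ i ∨ q = s * r ^ i) :
    Nonempty (DihedralGroup 4 ≃* Q) := by
  have hs' : s⁻¹ = s := inv_eq_of_mul_eq_one_left hs
  have hconj : ∀ i : ℤ, s * r ^ i * s = r ^ (-i) := by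
    intro i
    have h1 : s * r * s⁻¹ = r⁻¹ := by rw [hs']; exact eq_inv_of_mul_eq_one_left hsr
    calc s * r ^ i * s = s * r ^ i * s⁻¹ := by rw [hs']
      _ = (s * r * s⁻¹) ^ i := conj_zpow.symm
      _ = r ^ (-i) := by rw [h1, inv_zpow, zpow_neg]
  have hcast : ∀ i : ℤ, r ^ ((i : ZMod 4).cast : ℤ) = r ^ i := by
    intro i
    rw [ZMod.coe_intCast]
    conv_rhs => rw [← Int.emod_add_mul_ediv i 4]
    rw [zpow_add, zpow_mul]
    norm_cast
    simp [hr]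
  have hadd : ∀ i j : ZMod 4, r ^ ((i + j).cast : ℤ) = r ^ (i.cast : ℤ) * r ^ (j.cast : ℤ) := by
    intro i j
    rw [← zpow_add, ← hcast (i.cast + j.cast)]
    simp
  have hsub : ∀ i j : ZMod 4,
      r ^ ((i - j).cast : ℤ) = r ^ (i.cast : ℤ) * r ^ (-(j.cast : ℤ)) := by
    intro i j
    rw [← zpow_add, ← hcast (i.cast + -j.cast)]
    simp [sub_eq_add_neg]
  have hswap : ∀ i : ℤ, r ^ i * s = s * r ^ (-i) := by
    intro i
    rw [← hconj, ← mul_assoc, ← mul_assoc, hs, one_mul]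
  let F : DihedralGroup 4 →* Q :=
    { toFun := fun
        | .r i => r ^ (i.cast : ℤ)
        | .sr i => s * r ^ (i.cast : ℤ)
      map_one' := by
        change r ^ ((0 : ZMod 4).cast : ℤ) = 1
        simp
      map_mul' := by
        rintro (i | i) (j | j)
        · exact hadd i j
        · change s * r ^ ((j - i).cast : ℤ) = r ^ (i.cast : ℤ) * (s * r ^ (j.cast : ℤ))
          rw [← mul_assoc, hswap, sub_eq_neg_add, hadd, ← zero_sub, hsub]
          simp [mul_assoc]
        · change s * r ^ ((i + j).cast : ℤ) = s * r ^ (i.cast : ℤ) * r ^ (j.cast : ℤ)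
          rw [hadd, mul_assoc]
        · change r ^ ((j - i).cast : ℤ) = s * r ^ (i.cast : ℤ) * (s * r ^ (j.cast : ℤ))
          rw [← mul_assoc, hconj, sub_eq_neg_add, hadd, ← zero_sub, hsub]
          simp }
  refine ⟨MulEquiv.ofBijective F ⟨?_, ?_⟩⟩
  · rw [injective_iff_map_eq_one]
    have hrr : r * r ≠ 1 := by rwa [← pow_two]
    rintro (i | i) h
    · change r ^ (i.cast : ℤ) = 1 at h
      rw [DihedralGroup.one_def]
      congr 1
      have hd : orderOf r = 2 ^ (1 + 1) := by
        apply orderOf_eq_prime_pow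
        · simpa using hr2
        · simpa using hr
      have := orderOf_dvd_iff_zpow_eq_one.mpr h
      rw [hd] at this
      rw [← ZMod.intCast_zmod_cast i]
      exact (ZMod.intCast_zmod_eq_zero_iff_dvd _ 4).mpr (by simpa using this)
    · exfalso
      change s * r ^ (i.cast : ℤ) = 1 at h
      have hcomm : Commute s r := by
        rw [eq_inv_of_mul_eq_one_left h]
        exact ((Commute.refl r).zpow_left _).inv_left
      apply hrr
      rw [hcomm.eq, mul_assoc r s s, hs, mul_one] at hsr
      exact hsr
  · intro q
    obtain ⟨i, h | h⟩ := hgen q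
    · refine ⟨.r i, ?_⟩
      change r ^ (((i : ZMod 4)).cast : ℤ) = q
      rw [h, ← Int.cast_natCast i, hcast, zpow_natCast]
    · refine ⟨.sr i, ?_⟩
      change s * r ^ (((i : ZMod 4)).cast : ℤ) = q
      rw [h, ← Int.cast_natCast i, hcast, zpow_natCast]

/-- If `K` has index 2, and `A`, `B` are distinct subgroups of index 2 of `K` swapped under
conjugation by the elements outside `K`, then the quotient by `A ⊓ B` is dihedral of order 8. -/
theorem exists_surjective_hom_dihedralGroup_four {H : Type*} [Group H] (K A B : Subgroup H)
    (hAK : A ≤ K)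
    (hA : ∀ g ∈ K, ∀ h ∈ K, (g * h ∈ A ↔ (g ∈ A ↔ h ∈ A)))
    (hB : ∀ g ∈ K, ∀ h ∈ K, (g * h ∈ B ↔ (g ∈ B ↔ h ∈ B)))
    (hK : ∀ g ∉ K, ∀ h ∉ K, g * h ∈ K)
    (hswap : ∀ g ∉ K, ∀ k, (g * k * g⁻¹ ∈ A ↔ k ∈ B) ∧ (g * k * g⁻¹ ∈ B ↔ k ∈ A))
    {t a : H} (ht : t ∉ K) (haA : a ∈ A) (haB : a ∉ B) :
    ∃ f : H →* DihedralGroup 4, Function.Surjective f ∧ f.ker = A ⊓ B := by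
  have haK := hAK haA
  have hconjK : ∀ g ∉ K, ∀ k ∈ K, g * k * g⁻¹ ∈ K := by
    intro g hg k hk
    exact hK _ (fun h => hg ((K.mul_mem_cancel_right hk).mp h)) _ (by simpa using hg)
  obtain ⟨r, hrK, hrA, hrB⟩ : ∃ r ∉ K, r * r ∉ A ∧ r * r ∉ B := by
    have htt := hK t ht t ht
    have h1 : t * t ∈ A ↔ t * t ∈ B := by
      have := (hswap t ht (t * t)).1
      simpa [mul_assoc] using this
    by_cases h : t * t ∈ A
    · have htaK := hconjK t ht a haK
      have heq : t * a * (t * a) = t * a * t⁻¹ * (t * t * a) := by group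
      refine ⟨t * a, fun h => ht ((K.mul_mem_cancel_right haK).mp h), ?_, ?_⟩
      · rw [heq, hA _ htaK _ (mul_mem htt haK), hA _ htt _ haK, (hswap t ht a).1]
        tauto
      · rw [heq, hB _ htaK _ (mul_mem htt haK), hB _ htt _ haK, (hswap t ht a).2]
        tauto
    · exact ⟨t, ht, h, fun h' => h (h1.mpr h')⟩
  have hrrK := hK r hrK r hrK
  have hnormal : (A ⊓ B).Normal := by
    refine ⟨fun k hk g => ?_⟩
    by_cases hg : g ∈ K
    · have hkK := hAK hk.1
      constructor
      · change g * k * g⁻¹ ∈ A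
        rw [hA _ (mul_mem hg hkK) _ (inv_mem hg), hA _ hg _ hkK, inv_mem_iff]
        have := hk.1
        tauto
      · change g * k * g⁻¹ ∈ B
        rw [hB _ (mul_mem hg hkK) _ (inv_mem hg), hB _ hg _ hkK, inv_mem_iff]
        have := hk.2
        tauto
    · exact ⟨(hswap g hg k).1.mpr hk.2, (hswap g hg k).2.mpr hk.1⟩
  have hbits : ∀ g ∈ K, ∀ k ∈ K, (g ∈ A ↔ k ∈ A) → (g ∈ B ↔ k ∈ B) →
      (g : H ⧸ (A ⊓ B)) = k := by
    intro g hg k hk h1 h2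
    rw [QuotientGroup.eq]
    constructor
    · change g⁻¹ * k ∈ A
      rwa [hA _ (inv_mem hg) _ hk, inv_mem_iff]
    · change g⁻¹ * k ∈ B
      rwa [hB _ (inv_mem hg) _ hk, inv_mem_iff]
  have hgenK : ∀ k ∈ K, ∃ i : ℕ, (k : H ⧸ (A ⊓ B)) = (r : H ⧸ (A ⊓ B)) ^ i ∨
      (k : H ⧸ (A ⊓ B)) = (a : H ⧸ (A ⊓ B)) * (r : H ⧸ (A ⊓ B)) ^ i := by
    intro k hk
    have hA2 := hA a haK _ hrrK
    have hB2 := hB a haK _ hrrK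
    by_cases h1 : k ∈ A <;> by_cases h2 : k ∈ B
    · refine ⟨0, Or.inl ?_⟩
      rw [pow_zero]
      exact hbits k hk 1 (one_mem _) (by simpa) (by simpa)
    · refine ⟨0, Or.inr ?_⟩
      rw [pow_zero, mul_one]
      exact hbits k hk a haK (by tauto) (by tauto)
    · refine ⟨2, Or.inr ?_⟩
      rw [pow_two]
      exact hbits k hk (a * (r * r)) (mul_mem haK hrrK) (by tauto) (by tauto)
    · refine ⟨2, Or.inl ?_⟩
      rw [pow_two]
      exact hbits k hk (r * r) hrrK (by tauto) (by tauto)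
  obtain ⟨e⟩ := nonempty_mulEquiv_dihedralGroup_four (Q := H ⧸ (A ⊓ B)) r a
    (by
      rw [show (r : H ⧸ (A ⊓ B)) ^ 4 = ((r * r * (r * r) : H) : H ⧸ (A ⊓ B)) by
        simp only [QuotientGroup.mk_mul, pow_succ, pow_zero, one_mul, mul_assoc], QuotientGroup.eq_one_iff]
      exact ⟨(hA _ hrrK _ hrrK).mpr Iff.rfl, (hB _ hrrK _ hrrK).mpr Iff.rfl⟩)
    (by
      rw [← QuotientGroup.mk_mul, QuotientGroup.eq_one_iff]
      exact ⟨mul_mem haA haA, (hB _ haK _ haK).mpr Iff.rfl⟩)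
    (by
      have hraK := hconjK r hrK a haK
      rw [← QuotientGroup.mk_mul, ← QuotientGroup.mk_mul, ← QuotientGroup.mk_mul,
        QuotientGroup.eq_one_iff,
        show a * r * a * r = a * (r * a * r⁻¹ * (r * r)) by group]
      constructor
      · change _ ∈ A
        rw [hA _ haK _ (mul_mem hraK hrrK), hA _ hraK _ hrrK, (hswap r hrK a).1]
        tauto
      · change _ ∈ B
        rw [hB _ haK _ (mul_mem hraK hrrK), hB _ hraK _ hrrK, (hswap r hrK a).2]
        tauto)
    (by
      rw [pow_two, ← QuotientGroup.mk_mul, Ne, QuotientGroup.eq_one_iff]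
      exact fun h => hrA h.1)
    (by
      intro q
      obtain ⟨g, rfl⟩ := QuotientGroup.mk_surjective q
      by_cases hg : g ∈ K
      · exact hgenK g hg
      · obtain ⟨i, hi⟩ := hgenK (g * r⁻¹) (hK _ hg _ (by simpa using hrK))
        refine ⟨i + 1, ?_⟩
        have hgr : (g : H ⧸ (A ⊓ B)) = ((g * r⁻¹ : H) : H ⧸ (A ⊓ B)) * (r : H ⧸ (A ⊓ B)) := by
          rw [← QuotientGroup.mk_mul]; simp
        rw [hgr, pow_succ, ← mul_assoc]
        rcases hi with hi | hi
        · left; rw [hi]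
        · right; rw [hi])
  refine ⟨e.symm.toMonoidHom.comp (QuotientGroup.mk' (A ⊓ B)),
    e.symm.surjective.comp (QuotientGroup.mk'_surjective _), ?_⟩
  ext g
  simp

/-- The elements of `Lgrp n` are the maps `v ↦ v + w` and `v ↦ w - v`. -/
theorem eq_add_or_eq_sub_of_mem_Lgrp {n : ℕ} {l : Equiv.Perm (Vec n)} (hl : l ∈ Lgrp n) :
    ∃ w, (∀ v, l v = v + w) ∨ (∀ v, l v = w - v) := by
  induction hl using Subgroup.closure_induction with
  | mem f hf =>
    rcases hf with ⟨w, hw⟩ | hf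
    · exact ⟨w, Or.inl hw⟩
    · rw [Set.mem_singleton_iff] at hf
      exact ⟨0, Or.inr fun v => by simp [hf]⟩
  | one => exact ⟨0, Or.inl fun v => by simp⟩
  | mul f g _ _ hf hg =>
    obtain ⟨w, hf | hf⟩ := hf <;> obtain ⟨w', hg | hg⟩ := hg
    · exact ⟨w' + w, Or.inl fun v => by simp [hf, hg, add_assoc]⟩
    · exact ⟨w' + w, Or.inr fun v => by simp only [Equiv.Perm.mul_apply, hf, hg]; abel⟩
    · exact ⟨w - w', Or.inr fun v => by simp only [Equiv.Perm.mul_apply, hf, hg]; abel⟩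
    · exact ⟨w - w', Or.inl fun v => by simp only [Equiv.Perm.mul_apply, hf, hg]; abel⟩
  | inv f _ hf =>
    obtain ⟨w, hf | hf⟩ := hf
    · refine ⟨-w, Or.inl fun v => ?_⟩
      rw [Equiv.Perm.inv_eq_iff_eq, hf]; abel
    · refine ⟨w, Or.inr fun v => ?_⟩
      rw [Equiv.Perm.inv_eq_iff_eq, hf]; abel

section LocalAction

variable {α : Type*} {Γ : SimpleGraph α} {G : Type*} [Group G] [MulAction G α]

theorem mem_ballStab_one (hconn : Γ.Connected) {u : α} {g : G} :
    g ∈ ballStab Γ G u 1 ↔ g • u = u ∧ ∀ w, Γ.Adj u w → g • w = w := by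
  simp only [ballStab, Set.mem_ofPred_eq, Subgroup.mem_iInf, mem_stabilizer_iff]
  constructor
  · intro h
    exact ⟨h u (by simp), fun w hw => h w (SimpleGraph.dist_eq_one_iff_adj.mpr hw).le⟩
  · rintro ⟨h0, h1⟩ w hw
    rcases Nat.le_one_iff_eq_zero_or_eq_one.mp hw with h | h
    · rw [← hconn.dist_eq_zero_iff.mp h, h0]
    · exact h1 w (SimpleGraph.dist_eq_one_iff_adj.mp h)

/-- An element of a ball stabilizer that lies in the stabilizer of each ball adjacent to one it
stabilizes is trivial. -/
theorem eq_one_of_mem_ballStab (hconn : Γ.Connected)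
    (hfaith : ∀ g : G, (∀ u : α, g • u = u) → g = 1) {g : G} {x : α}
    (hx : g ∈ ballStab Γ G x 1)
    (hstep : ∀ u w, Γ.Adj u w → g ∈ ballStab Γ G u 1 → g ∈ ballStab Γ G w 1) : g = 1 := by
  have hwalk : ∀ u w, Γ.Walk u w → g ∈ ballStab Γ G u 1 → g ∈ ballStab Γ G w 1 := by
    intro u w p
    induction p with
    | nil => exact id
    | cons h _ ih => exact fun hu => ih (hstep _ _ h hu)
  exact hfaith g fun u =>
    ((mem_ballStab_one hconn).mp (hwalk x u (hconn.preconnected x u).some hx)).1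

theorem conj_mem_ballStab_one (hconn : Γ.Connected)
    (haut : ∀ (g : G) (u w : α), Γ.Adj u w ↔ Γ.Adj (g • u) (g • w)) {u : α} (h g : G) :
    h * g * h⁻¹ ∈ ballStab Γ G (h • u) 1 ↔ g ∈ ballStab Γ G u 1 := by
  have key : ∀ w : α, (h * g * h⁻¹) • (h • w) = h • w ↔ g • w = w := by
    intro w
    rw [mul_smul, mul_smul, inv_smul_smul, smul_left_cancel_iff]
  rw [mem_ballStab_one hconn, mem_ballStab_one hconn, key]
  refine and_congr_right fun _ => ⟨fun H w hw => ?_, fun H w hw => ?_⟩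
  · exact (key w).mp (H _ ((haut h u w).mp hw))
  · have := (key (h⁻¹ • w)).mpr (H _ ((haut h u _).mpr (by simpa using hw)))
    simpa using this

/-- The arc stabilizer induces a group of order at most two on the neighbourhood. -/
theorem mul_mem_ballStab_one_iff {n : ℕ} (hconn : Γ.Connected) (hloc : LocallyL n Γ G) {u w : α}
    (huw : Γ.Adj u w) {g h : G} (hgu : g • u = u) (hgw : g • w = w)
    (hhu : h • u = u) (hhw : h • w = w) :
    g * h ∈ ballStab Γ G u 1 ↔ (g ∈ ballStab Γ G u 1 ↔ h ∈ ballStab Γ G u 1) := by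
  obtain ⟨φ, hφ, -⟩ := hloc u
  have refl : ∀ k : G, k • u = u → k • w = w → k ∉ ballStab Γ G u 1 →
      ∃ c, ∀ z : Γ.neighborSet u, ∃ hz : k • (z : α) ∈ Γ.neighborSet u,
        φ ⟨k • (z : α), hz⟩ = c - φ z := by
    intro k hku hkw hk
    obtain ⟨l, hl, hlz⟩ := hφ k hku
    obtain ⟨c, hc | hc⟩ := eq_add_or_eq_sub_of_mem_Lgrp hl
    · exfalso
      apply hk
      obtain ⟨hw, hw'⟩ := hlz ⟨w, huw⟩
      have hc0 : c = 0 := by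
        have : (⟨k • w, hw⟩ : Γ.neighborSet u) = ⟨w, huw⟩ := Subtype.ext hkw
        rw [hc] at hw'
        change φ ⟨k • w, hw⟩ = _ at hw'
        rw [this] at hw'
        simpa using hw'
      refine (mem_ballStab_one hconn).mpr ⟨hku, fun z hz => ?_⟩
      obtain ⟨hz1, hz2⟩ := hlz ⟨z, hz⟩
      rw [hc, hc0, add_zero] at hz2
      exact congrArg Subtype.val (φ.injective hz2)
    · refine ⟨c, fun z => ?_⟩
      obtain ⟨hz1, hz2⟩ := hlz z
      exact ⟨hz1, by rw [hz2, hc]⟩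
  by_cases hg : g ∈ ballStab Γ G u 1
  · rw [Subgroup.mul_mem_cancel_left _ hg]; tauto
  by_cases hh : h ∈ ballStab Γ G u 1
  · rw [Subgroup.mul_mem_cancel_right _ hh]; tauto
  refine ⟨fun _ => by tauto, fun _ => ?_⟩
  obtain ⟨c, hc⟩ := refl g hgu hgw hg
  obtain ⟨d, hd⟩ := refl h hhu hhw hh
  have hcd : c = d := by
    obtain ⟨hw, hw'⟩ := hc ⟨w, huw⟩
    obtain ⟨hv, hv'⟩ := hd ⟨w, huw⟩
    have : (⟨g • w, hw⟩ : Γ.neighborSet u) = ⟨h • w, hv⟩ := Subtype.ext (hgw.trans hhw.symm)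
    have h3 := hw'.symm.trans ((congrArg φ this).trans hv')
    exact sub_left_injective h3
  refine (mem_ballStab_one hconn).mpr ⟨by rw [mul_smul, hhu, hgu], fun z hz => ?_⟩
  obtain ⟨hz1, hz2⟩ := hd ⟨z, hz⟩
  obtain ⟨hz3, hz4⟩ := hc ⟨h • z, hz1⟩
  rw [hz2, hcd, sub_sub_cancel] at hz4
  rw [mul_smul]
  exact congrArg Subtype.val (φ.injective hz4)

/-- Arc stabilizers are 2-groups: elements of odd order act trivially. -/
theorem exists_pow_two_pow_eq_one {n : ℕ} (hconn : Γ.Connected)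
    (hfaith : ∀ g : G, (∀ u : α, g • u = u) → g = 1) (hloc : LocallyL n Γ G) {x y : α}
    (hfin : Finite (stabilizer G x)) (hxy : Γ.Adj x y) {g : G} (hgx : g • x = x)
    (hgy : g • y = y) : ∃ k : ℕ, g ^ 2 ^ k = 1 := by
  have hpos : 0 < orderOf g := by
    have := orderOf_pos (⟨g, hgx⟩ : stabilizer G x)
    rwa [← Subgroup.orderOf_coe] at this
  obtain ⟨k, m, hm, hkm⟩ := Nat.exists_eq_two_pow_mul_odd hpos.ne'
  refine ⟨k, ?_⟩
  have hodd : (g ^ 2 ^ k) ^ m = 1 := by rw [← pow_mul, ← hkm, pow_orderOf_eq_one]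
  have hstep : ∀ u w, Γ.Adj u w → (g ^ 2 ^ k) • u = u → (g ^ 2 ^ k) • w = w →
      g ^ 2 ^ k ∈ ballStab Γ G u 1 := by
    intro u w huw hu hw
    have h2 := (mul_mem_ballStab_one_iff hconn hloc huw hu hw hu hw).mpr Iff.rfl
    obtain ⟨j, rfl⟩ := hm
    rw [pow_succ, pow_mul, pow_two] at hodd
    rw [← inv_mem_iff, ← eq_inv_of_mul_eq_one_left hodd]
    exact pow_mem h2 j
  have hpow : ∀ z : α, g • z = z → (g ^ 2 ^ k) • z = z := fun z hz =>
    (stabilizer G z).pow_mem hz _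
  refine eq_one_of_mem_ballStab hconn hfaith (x := x) (hstep x y hxy (hpow x hgx) (hpow y hgy)) ?_
  intro u w huw hu
  rw [mem_ballStab_one hconn] at hu
  exact hstep w u huw.symm (hu.2 w huw) hu.1

theorem mem_stabilizer_pair {x y : α} {g : G} :
    g ∈ stabilizer G ({x, y} : Set α) ↔ g • x = x ∧ g • y = y ∨ g • x = y ∧ g • y = x := by
  rw [mem_stabilizer_iff, Set.smul_set_insert, Set.smul_set_singleton, Set.pair_eq_pair_iff]

end LocalAction

/-- `G_e` is a 2-group, `G_e/G_{xy}^{[1]} ≅ Dih(8)`, and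
`G_x^{[1]}·G_y^{[1]} = G_x ∩ G_y`. -/
theorem edge_stabilizer_structure
    {α : Type*} (n : ℕ) (hn : 2 ≤ n) (Γ : SimpleGraph α)
    (G : Type*) [Group G] [MulAction G α]
    (hconn : Γ.Connected) (hacyc : Γ.IsAcyclic)
    (haut : ∀ (g : G) (u w : α), Γ.Adj u w ↔ Γ.Adj (g • u) (g • w))
    (hfaith : ∀ g : G, (∀ u : α, g • u = u) → g = 1)
    (harc : ∀ u w u' w' : α, Γ.Adj u w → Γ.Adj u' w' → ∃ g : G, g • u = u' ∧ g • w = w')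
    (hfin : ∀ u : α, Finite (stabilizer G u))
    (hloc : LocallyL n Γ G)
    (x y : α) (hxy : Γ.Adj x y)
    (hntriv : ballStab Γ G x 1 ⊓ ballStab Γ G y 1 ≠ ⊥)
 :
    IsPGroup 2 (stabilizer G ({x, y} : Set α)) ∧
    (∃ f : stabilizer G ({x, y} : Set α) →* DihedralGroup 4,
      Function.Surjective f ∧
      f.ker = (ballStab Γ G x 1 ⊓ ballStab Γ G y 1).subgroupOf
        (stabilizer G ({x, y} : Set α))) ∧
    (ballStab Γ G x 1 : Set G) * (ballStab Γ G y 1 : Set G) =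
      ((stabilizer G x ⊓ stabilizer G y : Subgroup G) : Set G) := by
  have hmem : ∀ {u : α} {g : G}, g ∈ ballStab Γ G u 1 ↔ g • u = u ∧ ∀ w, Γ.Adj u w → g • w = w :=
    mem_ballStab_one hconn
  obtain ⟨a, haA, haB⟩ : ∃ a ∈ ballStab Γ G x 1, a ∉ ballStab Γ G y 1 := by
    by_contra! hle
    apply hntriv
    rw [eq_bot_iff]
    intro g hg
    refine eq_one_of_mem_ballStab hconn hfaith hg.1 fun u w huw hu => ?_
    obtain ⟨h, rfl, rfl⟩ := harc x y u w hxy huw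
    have key : ∀ z, g ∈ ballStab Γ G (h • z) 1 ↔ h⁻¹ * g * h ∈ ballStab Γ G z 1 := by
      intro z
      rw [← conj_mem_ballStab_one hconn haut h (h⁻¹ * g * h)]
      simp [mul_assoc]
    rw [key] at hu ⊢
    exact hle _ hu
  have hA : ∀ g h : G, g • x = x ∧ g • y = y → h • x = x ∧ h • y = y →
      (g * h ∈ ballStab Γ G x 1 ↔ (g ∈ ballStab Γ G x 1 ↔ h ∈ ballStab Γ G x 1)) :=
    fun g h hg hh => mul_mem_ballStab_one_iff hconn hloc hxy hg.1 hg.2 hh.1 hh.2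
  have hB : ∀ g h : G, g • x = x ∧ g • y = y → h • x = x ∧ h • y = y →
      (g * h ∈ ballStab Γ G y 1 ↔ (g ∈ ballStab Γ G y 1 ↔ h ∈ ballStab Γ G y 1)) :=
    fun g h hg hh => mul_mem_ballStab_one_iff hconn hloc hxy.symm hg.2 hg.1 hh.2 hh.1
  have hAK : ∀ g ∈ ballStab Γ G x 1, g • x = x ∧ g • y = y :=
    fun g hg => ⟨(hmem.mp hg).1, (hmem.mp hg).2 y hxy⟩
  have hBK : ∀ g ∈ ballStab Γ G y 1, g • x = x ∧ g • y = y :=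
    fun g hg => ⟨(hmem.mp hg).2 x hxy.symm, (hmem.mp hg).1⟩
  refine ⟨?_, ?_, ?_⟩
  · rintro ⟨g, hg⟩
    obtain ⟨k, hk⟩ : ∃ k : ℕ, (g * g) ^ 2 ^ k = 1 := by
      apply exists_pow_two_pow_eq_one hconn hfaith hloc (hfin x) hxy
      all_goals
        rw [mul_smul]
        rcases mem_stabilizer_pair.mp hg with h | h <;> simp [h.1, h.2]
    refine ⟨k + 1, Subtype.ext ?_⟩
    rw [pow_succ', pow_mul, pow_two]
    exact hk
  · obtain ⟨t, htx, hty⟩ := harc x y y x hxy hxy.symm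
    have hor : ∀ g : stabilizer G ({x, y} : Set α),
        g ∉ (stabilizer G x ⊓ stabilizer G y).subgroupOf (stabilizer G ({x, y} : Set α)) →
        (g : G) • x = y ∧ (g : G) • y = x :=
      fun g hg => (mem_stabilizer_pair.mp g.2).resolve_left hg
    apply exists_surjective_hom_dihedralGroup_four
      ((stabilizer G x ⊓ stabilizer G y).subgroupOf (stabilizer G ({x, y} : Set α)))
      ((ballStab Γ G x 1).subgroupOf (stabilizer G ({x, y} : Set α)))
      ((ballStab Γ G y 1).subgroupOf (stabilizer G ({x, y} : Set α)))
      (t := ⟨t, mem_stabilizer_pair.mpr (Or.inr ⟨htx, hty⟩)⟩)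
      (a := ⟨a, mem_stabilizer_pair.mpr (Or.inl (hAK a haA))⟩)
    · exact fun g hg => hAK g hg
    · exact fun g hg h hh => hA g h hg hh
    · exact fun g hg h hh => hB g h hg hh
    · intro g hg h hh
      obtain ⟨h1, h2⟩ := hor g hg
      obtain ⟨h3, h4⟩ := hor h hh
      constructor
      · change ((g : G) * (h : G)) • x = x
        rw [mul_smul, h3, h2]
      · change ((g : G) * (h : G)) • y = y
        rw [mul_smul, h4, h1]
    · intro g hg k
      obtain ⟨h1, h2⟩ := hor g hg
      constructor
      · have := conj_mem_ballStab_one hconn haut (u := y) (g : G) (k : G)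
        rwa [h2] at this
      · have := conj_mem_ballStab_one hconn haut (u := x) (g : G) (k : G)
        rwa [h1] at this
    · intro ht
      exact hxy.ne (ht.1.symm.trans htx)
    · exact haA
    · exact haB
  · ext k
    rw [Set.mem_mul]
    constructor
    · rintro ⟨g, hg, h, hh, rfl⟩
      exact mul_mem (S := Subgroup G) (hAK g hg) (hBK h hh)
    · intro hk
      by_cases h1 : k ∈ ballStab Γ G x 1
      · exact ⟨k, h1, 1, one_mem _, mul_one k⟩
      by_cases h2 : k ∈ ballStab Γ G y 1
      · exact ⟨1, one_mem _, k, h2, one_mul k⟩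
      refine ⟨a, haA, a⁻¹ * k, ?_, by simp⟩
      change a⁻¹ * k ∈ ballStab Γ G y 1
      rw [hB _ _ (hAK _ (inv_mem haA)) hk, inv_mem_iff]
      tauto
end
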